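/- Let K be a field of positive characteristic p, m < n positive integers, X the m×n generic matrix over S = K[x_{ij}], and let I = I_1 + I_2 + ... + I_k, where each I_i is either I_{t_i}(X_{[a_i,b_i]}) (minors on consecutive columns) or I_{t_i}(X^{[a_i,b_i]}) (minors on consecutive rows). Then S/I is F-split: there exists an additive map φ : S/I → S/I with φ(a^p · x) = a · φ(x) for all a, x and φ(1) = 1. In particular S/I is F-pure and I is a radical ideal. -/

import Mathlib

/-- The ideal of `t × t` minors of the generic `m × n` matrix `X` (with entries
`X i j = MvPolynomial.X (i, j)`), using only rows with 1-based index in `[r1, r2]`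
and columns with 1-based index in `[c1, c2]`. -/
noncomputable def genMinors (K : Type*) [Field K] (m n : ℕ) (t : ℕ) (r1 r2 c1 c2 : ℕ) :
    Ideal (MvPolynomial (Fin m × Fin n) K) :=
  Ideal.span { p | ∃ (r : Fin t → Fin m) (c : Fin t → Fin n),
    StrictMono r ∧ StrictMono c ∧
    (∀ i, r1 ≤ (r i).val + 1 ∧ (r i).val + 1 ≤ r2) ∧
    (∀ j, c1 ≤ (c j).val + 1 ∧ (c j).val + 1 ≤ c2) ∧
    p = Matrix.det (Matrix.of fun i j => MvPolynomial.X (r i, c j)) }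

namespace SMF
open MvPolynomial

/-- tail sum -/
def tailSum {m n : ℕ} (x : Fin m → Fin n → ℕ) (p : Fin m) (q : Fin n) : ℕ :=
  ∑ i, ∑ j, if p ≤ i ∧ q ≤ j then x i j else 0

/-- weight of an exponent matrix -/
def wt {m n : ℕ} (x : Fin m → Fin n → ℕ) : ℕ :=
  ∑ i : Fin m, ∑ j : Fin n, (i.val + 1) * (j.val + 1) * x i j

lemma sum_le_ind {n : ℕ} (j : Fin n) : (∑ q : Fin n, if q ≤ j then 1 else 0) = j.val + 1 := by
  rw [Finset.sum_boole]
  have : (Finset.univ.filter fun q : Fin n => q ≤ j) = Finset.Iic j := by ext; simp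
  rw [this]; simp

lemma wt_eq {m n : ℕ} (x : Fin m → Fin n → ℕ) : wt x = ∑ p, ∑ q, tailSum x p q := by
  unfold wt tailSum
  have h1 : ∀ i j, (i.val + 1) * (j.val + 1) * x i j =
      ∑ p : Fin m, ∑ q : Fin n, if p ≤ i ∧ q ≤ j then x i j else 0 := by
    intro i j
    rw [← sum_le_ind i, ← sum_le_ind j, Finset.sum_mul_sum, Finset.sum_mul]
    refine Finset.sum_congr rfl fun p _ => ?_
    rw [Finset.sum_mul]
    refine Finset.sum_congr rfl fun q _ => ?_
    by_cases h : p ≤ i <;> by_cases h' : q ≤ j <;> simp [h, h']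
  simp_rw [h1]
  calc _ = ∑ i : Fin m, ∑ p : Fin m, ∑ j : Fin n, ∑ q : Fin n, (if p ≤ i ∧ q ≤ j then x i j else 0) :=
        Finset.sum_congr rfl fun i _ => Finset.sum_comm
    _ = ∑ p : Fin m, ∑ i : Fin m, ∑ j : Fin n, ∑ q : Fin n, (if p ≤ i ∧ q ≤ j then x i j else 0) :=
        Finset.sum_comm
    _ = ∑ p : Fin m, ∑ i : Fin m, ∑ q : Fin n, ∑ j : Fin n, (if p ≤ i ∧ q ≤ j then x i j else 0) :=
        Finset.sum_congr rfl fun i _ => Finset.sum_congr rfl fun i _ => Finset.sum_comm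
    _ = _ := Finset.sum_congr rfl fun i _ => Finset.sum_comm

lemma tail_identity {m n : ℕ} (x : Fin m → Fin n → ℕ) (p : Fin m) (q : Fin n) :
    tailSum x p q + (∑ i, if i < p then ∑ j, x i j else 0) + (∑ j, if j < q then ∑ i, x i j else 0)
      = (∑ i, ∑ j, x i j) + ∑ i, ∑ j, if i < p ∧ j < q then x i j else 0 := by
  have h2 : (∑ j, if j < q then ∑ i, x i j else 0) = ∑ i, ∑ j, if j < q then x i j else 0 := by
    rw [Finset.sum_comm]
    refine Finset.sum_congr rfl fun j _ => ?_
    split_ifs <;> simp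
  have h1 : (∑ i, if i < p then ∑ j, x i j else 0) = ∑ i, ∑ j, if i < p then x i j else 0 := by
    refine Finset.sum_congr rfl fun j _ => ?_
    split_ifs <;> simp
  rw [h1, h2]
  unfold tailSum
  simp only [← Finset.sum_add_distrib]
  refine Finset.sum_congr rfl fun i _ => Finset.sum_congr rfl fun j _ => ?_
  rcases lt_or_ge i p with h | h <;> rcases lt_or_ge j q with h' | h' <;>
    simp [h, h', not_le.mpr, not_lt.mpr]

lemma AC {m n : ℕ} (a b : Fin m → Fin n → ℕ) (hrow : ∀ i, ∑ j, a i j = ∑ j, b i j)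
    (hcol : ∀ j, ∑ i, a i j = ∑ i, b i j)
    (hac : ∀ i j i' j', a i j ≠ 0 → a i' j' ≠ 0 → i < i' → j < j' → False) :
    wt a ≤ wt b ∧ (wt a = wt b → a = b) := by
  have hle : ∀ p q, tailSum a p q ≤ tailSum b p q := by
    intro p q
    have ha := tail_identity a p q
    have hb := tail_identity b p q
    simp only [hrow, hcol] at ha
    by_cases h0 : (∑ i, ∑ j, if i < p ∧ j < q then a i j else 0) = 0
    · omega
    · have : tailSum a p q = 0 := by
        by_contra h1
        unfold tailSum at h1
        obtain ⟨i, _, hi⟩ := Finset.exists_ne_zero_of_sum_ne_zero h0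
        obtain ⟨j, _, hj⟩ := Finset.exists_ne_zero_of_sum_ne_zero hi
        obtain ⟨i', _, hi'⟩ := Finset.exists_ne_zero_of_sum_ne_zero h1
        obtain ⟨j', _, hj'⟩ := Finset.exists_ne_zero_of_sum_ne_zero hi'
        split_ifs at hj hj' with h3 h4
        · exact hac i j i' j' hj hj' (lt_of_lt_of_le h3.1 h4.1) (lt_of_lt_of_le h3.2 h4.2)
        all_goals simp_all
      omega
  refine ⟨by rw [wt_eq, wt_eq]; exact Finset.sum_le_sum fun p _ => Finset.sum_le_sum fun q _ => hle p q, ?_⟩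
  intro heq
  have hT : ∀ p q, tailSum a p q = tailSum b p q := by
    rw [wt_eq, wt_eq, ← Finset.sum_product', ← Finset.sum_product'] at heq
    have := (Finset.sum_eq_sum_iff_of_le (fun x _ => hle x.1 x.2)).1 heq
    intro p q
    exact this (p, q) (by simp)
  by_contra hne
  have hS : (Finset.univ.filter fun v : Fin m × Fin n => a v.1 v.2 ≠ b v.1 v.2).Nonempty := by
    by_contra hS
    apply hne
    funext i j
    by_contra hij
    exact hS ⟨(i, j), by simpa using hij⟩
  obtain ⟨⟨p, q⟩, hv, hmax⟩ := Finset.exists_max_image _ (fun v : Fin m × Fin n => v.1.val + v.2.val) hS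
  have := hT p q
  unfold tailSum at this
  rw [← Finset.sum_product', ← Finset.sum_product', 
    ← Finset.add_sum_erase _ _ (show (p, q) ∈ Finset.univ ×ˢ Finset.univ by simp),
    ← Finset.add_sum_erase _ _ (show (p, q) ∈ Finset.univ ×ˢ Finset.univ by simp)] at this
  have h2 : ∑ x ∈ (Finset.univ ×ˢ Finset.univ).erase (p, q), (if p ≤ x.1 ∧ q ≤ x.2 then a x.1 x.2 else 0) =
      ∑ x ∈ (Finset.univ ×ˢ Finset.univ).erase (p, q), (if p ≤ x.1 ∧ q ≤ x.2 then b x.1 x.2 else 0) := by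
    refine Finset.sum_congr rfl fun x hx => ?_
    split_ifs with h
    · by_contra hab
      have := hmax x (by simpa using hab)
      have h1 := Fin.le_def.1 h.1
      have h2 := Fin.le_def.1 h.2
      simp only at this
      apply (Finset.mem_erase.1 hx).1
      ext <;> simp <;> omega
    · rfl
  simp at hv
  rw [h2] at this
  simp at this
  exact hv this

lemma mirsky {m n : ℕ} (r : ℕ) : ∀ (F : Set (Fin m × Fin n))
    (_ : ¬ ∃ (R : Fin (r+1) → Fin m) (C : Fin (r+1) → Fin n), StrictMono R ∧ StrictMono C ∧
      ∀ s, (R s, C s) ∈ F), ∃ κ : Fin m × Fin n → ℕ, (∀ v ∈ F, κ v < r) ∧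
      ∀ v ∈ F, ∀ w ∈ F, v.1 < w.1 → v.2 < w.2 → κ v ≠ κ w := by
  induction r with
  | zero =>
    intro F h
    have hF : ∀ v, v ∉ F := by
      intro v hv
      exact h ⟨fun _ => v.1, fun _ => v.2, fun x y hxy => by omega, fun x y hxy => by omega, fun _ => hv⟩
    exact ⟨fun _ => 0, fun v hv => (hF v hv).elim, fun v hv => (hF v hv).elim⟩
  | succ r ih =>
    intro F h
    classical
    let F' : Set (Fin m × Fin n) := {v | v ∈ F ∧ ∃ w ∈ F, w.1 < v.1 ∧ w.2 < v.2}
    obtain ⟨κ, h1, h2⟩ := ih F' (by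
      rintro ⟨R, C, hR, hC, hRC⟩
      obtain ⟨w, hw, hw1, hw2⟩ := (hRC 0).2
      refine h ⟨Matrix.vecCons w.1 R, Matrix.vecCons w.2 C, hR.vecCons hw1, hC.vecCons hw2, ?_⟩
      intro s
      refine Fin.cases ?_ (fun s => ?_) s
      · simpa using hw
      · simpa using (hRC s).1)
    refine ⟨fun v => if v ∈ F' then κ v else r, ?_, ?_⟩
    · intro v hv
      simp only
      split_ifs with h3
      · exact (h1 v h3).trans (Nat.lt_succ_self _)
      · exact Nat.lt_succ_self _
    · intro v hv w hw hvw1 hvw2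
      have hw' : w ∈ F' := ⟨hw, v, hv, hvw1, hvw2⟩
      simp only [hw', if_true]
      split_ifs with h3
      · exact h2 v h3 w hw' hvw1 hvw2
      · exact (h1 w hw').ne'

/-- variables of the parametrizing ring -/
abbrev Tau (m n r : ℕ) := (Fin m × Fin r) ⊕ (Fin r × Fin n) ⊕ (Fin m × Fin n)

/-- image of a variable -/
noncomputable def phiFun (K : Type*) [Field K] {m n : ℕ} (B : Finset (Fin n)) (r : ℕ)
    (v : Fin m × Fin n) : MvPolynomial (Tau m n r) K :=
  if v.2 ∈ B then ∑ k : Fin r, X (Sum.inl (v.1, k)) * X (Sum.inr (Sum.inl (k, v.2)))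
  else X (Sum.inr (Sum.inr v))

/-- the parametrization of matrices whose `B`-columns have rank at most `r` -/
noncomputable def Phi (K : Type*) [Field K] {m n : ℕ} {σ : Type*} (E : Fin m × Fin n ≃ σ)
    (B : Finset (Fin n)) (r : ℕ) : MvPolynomial σ K →ₐ[K] MvPolynomial (Tau m n r) K :=
  aeval (fun s => phiFun K B r (E.symm s))

/-- exponent in the parametrizing ring -/
noncomputable def muOf {m n r : ℕ} (ν : Fin r → Fin m → Fin n → ℕ) (w : Fin m → Fin n → ℕ) :
    Tau m n r →₀ ℕ :=
  Finsupp.equivFunOnFinite.symm (fun s => match s with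
    | Sum.inl (i, k) => ∑ j, ν k i j
    | Sum.inr (Sum.inl (k, j)) => ∑ i, ν k i j
    | Sum.inr (Sum.inr (i, j)) => w i j)

@[simp] lemma muOf_inl {m n r : ℕ} (ν : Fin r → Fin m → Fin n → ℕ) (w : Fin m → Fin n → ℕ) (i k) :
    muOf ν w (Sum.inl (i, k)) = ∑ j, ν k i j := rfl
@[simp] lemma muOf_inr_inl {m n r : ℕ} (ν : Fin r → Fin m → Fin n → ℕ) (w : Fin m → Fin n → ℕ)
    (k j) : muOf ν w (Sum.inr (Sum.inl (k, j))) = ∑ i, ν k i j := rfl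
@[simp] lemma muOf_inr_inr {m n r : ℕ} (ν : Fin r → Fin m → Fin n → ℕ) (w : Fin m → Fin n → ℕ)
    (i j) : muOf ν w (Sum.inr (Sum.inr (i, j))) = w i j := rfl

lemma muOf_add {m n r : ℕ} (ν ν' : Fin r → Fin m → Fin n → ℕ) (w w' : Fin m → Fin n → ℕ) :
    muOf (ν + ν') (w + w') = muOf ν w + muOf ν' w' := by
  ext s
  rcases s with ⟨i, k⟩ | ⟨k, j⟩ | ⟨i, j⟩ <;> simp [Finset.sum_add_distrib]

/-- indicator -/
def ind1 {m n : ℕ} (v : Fin m × Fin n) : Fin m → Fin n → ℕ :=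
  fun i j => if i = v.1 ∧ j = v.2 then 1 else 0

/-- colored indicator -/
def ind {m n r : ℕ} (k0 : Fin r) (v : Fin m × Fin n) : Fin r → Fin m → Fin n → ℕ :=
  fun k => if k = k0 then ind1 v else 0

lemma muOf_ind {m n r : ℕ} (k0 : Fin r) (v : Fin m × Fin n) :
    muOf (ind k0 v) 0 = Finsupp.single (Sum.inl (v.1, k0)) 1 +
      Finsupp.single (Sum.inr (Sum.inl (k0, v.2))) 1 := by
  obtain ⟨i0, j0⟩ := v
  ext s
  rcases s with ⟨i, k⟩ | ⟨k, j⟩ | ⟨i, j⟩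
  · by_cases hk : k = k0 <;> by_cases hi : i = i0 <;>
      simp [ind, ind1, Finsupp.single_apply, hk, hi, eq_comm]
    all_goals aesop
  · by_cases hk : k = k0 <;> by_cases hi : j = j0 <;>
      simp [ind, ind1, Finsupp.single_apply, hk, hi, eq_comm]
    all_goals aesop
  · simp [Finsupp.single_apply]

lemma muOf_ind1 {m n r : ℕ} (v : Fin m × Fin n) :
    muOf (0 : Fin r → Fin m → Fin n → ℕ) (ind1 v) = Finsupp.single (Sum.inr (Sum.inr v)) 1 := by
  obtain ⟨i0, j0⟩ := v
  ext s
  rcases s with ⟨i, k⟩ | ⟨k, j⟩ | ⟨i, j⟩ <;>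
      simp [ind1, Finsupp.single_apply, eq_comm]

lemma phiFun_of_mem (K : Type*) [Field K] {m n : ℕ} (B : Finset (Fin n)) (r : ℕ)
    (v : Fin m × Fin n) (h : v.2 ∈ B) :
    phiFun K B r v = ∑ k : Fin r, monomial (muOf (ind k v) 0) 1 := by
  simp only [phiFun, h, if_true, muOf_ind]
  refine Finset.sum_congr rfl fun k _ => ?_
  simp [X, monomial_mul]

lemma phiFun_of_notMem (K : Type*) [Field K] {m n : ℕ} (B : Finset (Fin n)) (r : ℕ)
    (v : Fin m × Fin n) (h : v.2 ∉ B) :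
    phiFun K B r v = monomial (muOf 0 (ind1 v)) 1 := by
  simp only [phiFun, h, if_false, muOf_ind1]
  rfl

/-- decomposition of an exponent matrix into colored pieces -/
structure Fam {m n r : ℕ} (B : Finset (Fin n)) (x : Fin m → Fin n → ℕ)
    (ν : Fin r → Fin m → Fin n → ℕ) (w : Fin m → Fin n → ℕ) : Prop where
  sum : ∑ k, ν k + w = x
  w0 : ∀ i, ∀ j ∈ B, w i j = 0
  n0 : ∀ k i, ∀ j ∉ B, ν k i j = 0

lemma Fam.add {m n r : ℕ} {B : Finset (Fin n)} {x x' : Fin m → Fin n → ℕ}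
    {ν ν' : Fin r → Fin m → Fin n → ℕ} {w w' : Fin m → Fin n → ℕ} (h : Fam B x ν w)
    (h' : Fam B x' ν' w') : Fam B (x + x') (ν + ν') (w + w') := by
  refine ⟨?_, fun i j hj => ?_, fun k i j hj => ?_⟩
  · rw [← h.sum, ← h'.sum]
    simp only [Pi.add_apply, Finset.sum_add_distrib]
    abel
  · simp [h.w0 i j hj, h'.w0 i j hj]
  · simp [h.n0 k i j hj, h'.n0 k i j hj]

lemma Fam_ind {m n r : ℕ} {B : Finset (Fin n)} (k : Fin r) (v : Fin m × Fin n) (h : v.2 ∈ B) :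
    Fam B (ind1 v) (ind k v) 0 := by
  refine ⟨?_, fun i j hj => rfl, fun k i j hj => ?_⟩
  · simp [ind]
  · simp only [ind]
    split_ifs
    · simp [ind1]; rintro rfl rfl; exact hj h
    · rfl

lemma Fam_ind1 {m n r : ℕ} {B : Finset (Fin n)} (v : Fin m × Fin n) (h : v.2 ∉ B) :
    Fam B (ind1 v) (0 : Fin r → Fin m → Fin n → ℕ) (ind1 v) := by
  refine ⟨?_, fun i j hj => ?_, fun k i j hj => rfl⟩
  · simp
  · simp [ind1]; rintro rfl rfl; exact h hj

/-- exponents as matrices -/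
def mat {m n : ℕ} {σ : Type*} (E : Fin m × Fin n ≃ σ) (y : σ →₀ ℕ) : Fin m → Fin n → ℕ :=
  fun i j => y (E (i, j))

lemma mat_add {m n : ℕ} {σ : Type*} (E : Fin m × Fin n ≃ σ) (y y' : σ →₀ ℕ) :
    mat E (y + y') = mat E y + mat E y' := rfl

lemma mat_single {m n : ℕ} {σ : Type*} (E : Fin m × Fin n ≃ σ) (v) :
    mat E (Finsupp.single (E v) 1) = ind1 v := by
  classical
  funext i j
  obtain ⟨a, b⟩ := v
  simp [mat, ind1, Finsupp.single_apply, eq_comm]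

lemma mat_inj {m n : ℕ} {σ : Type*} (E : Fin m × Fin n ≃ σ) {y y' : σ →₀ ℕ}
    (h : mat E y = mat E y') : y = y' := by
  ext s
  obtain ⟨⟨i, j⟩, rfl⟩ := E.surjective s
  exact congrFun (congrFun h i) j

lemma Phi_X (K : Type*) [Field K] {m n : ℕ} {σ : Type*} (E : Fin m × Fin n ≃ σ)
    (B : Finset (Fin n)) (r : ℕ) (v) : Phi K E B r (X (E v)) = phiFun K B r v := by
  simp [Phi]

lemma Phi_single (K : Type*) [Field K] {m n : ℕ} {σ : Type*} (E : Fin m × Fin n ≃ σ)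
    (B : Finset (Fin n)) (r : ℕ) (v) :
    Phi K E B r (monomial (Finsupp.single (E v) 1) 1) = phiFun K B r v := Phi_X K E B r v

lemma Phi_mono_add (K : Type*) [Field K] {m n : ℕ} {σ : Type*} (E : Fin m × Fin n ≃ σ)
    (B : Finset (Fin n)) (r : ℕ) (y y') :
    Phi K E B r (monomial (y + y') 1) = Phi K E B r (monomial y 1) * Phi K E B r (monomial y' 1) := by
  rw [← map_mul, monomial_mul, mul_one]

lemma exp_induction {σ : Type*} (Q : (σ →₀ ℕ) → Prop) (h0 : Q 0)
    (h1 : ∀ y s, Q y → Q (y + Finsupp.single s 1)) (y) : Q y := by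
  have key : ∀ (c : ℕ) s y, Q y → Q (y + Finsupp.single s c) := by
    intro c s
    induction c with
    | zero => intro y hy; simpa using hy
    | succ c ih =>
      intro y hy
      rw [Finsupp.single_add, ← add_assoc]
      exact h1 _ _ (ih y hy)
  induction y using Finsupp.induction with
  | zero => exact h0
  | single_add a b f _ _ ih => rw [add_comm]; exact key _ _ _ ih

lemma L1 (K : Type*) [Field K] {m n : ℕ} {σ : Type*} (E : Fin m × Fin n ≃ σ)
    (B : Finset (Fin n)) (r : ℕ) (y : σ →₀ ℕ) : ∀ μ, coeff μ (Phi K E B r (monomial y 1)) ≠ 0 →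
      ∃ ν w, Fam B (mat E y) ν w ∧ μ = muOf ν w := by
  classical
  induction y using exp_induction with
  | h0 =>
    intro μ h
    have : (monomial (0 : σ →₀ ℕ) (1 : K)) = 1 := rfl
    rw [this, map_one, coeff_one] at h
    refine ⟨0, 0, ⟨by simp; rfl, by simp, by simp⟩, ?_⟩
    have h : 0 = μ := by by_contra h'; simp [h'] at h
    rw [← h]
    ext s
    rcases s with ⟨i, k⟩ | ⟨k, j⟩ | ⟨i, j⟩ <;> simp
  | h1 y s ih =>
    intro μ h
    obtain ⟨v, rfl⟩ := E.surjective s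
    rw [Phi_mono_add, Phi_single] at h
    rw [mat_add, mat_single]
    have h := support_mul _ _ (mem_support_iff.2 h)
    obtain ⟨μ1, h1, μ2, h2, rfl⟩ := Finset.mem_add.1 h
    obtain ⟨ν, w, hF, rfl⟩ := ih μ1 (mem_support_iff.1 h1)
    rw [mem_support_iff] at h2
    by_cases hv : v.2 ∈ B
    · rw [phiFun_of_mem _ _ _ _ hv, coeff_sum] at h2
      obtain ⟨k, _, hk⟩ := Finset.exists_ne_zero_of_sum_ne_zero h2
      rw [coeff_monomial] at hk
      have hk : muOf (ind k v) 0 = μ2 := by by_contra h'; simp [h'] at hk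
      exact ⟨_, _, hF.add (Fam_ind k v hv), by rw [muOf_add, hk]⟩
    · rw [phiFun_of_notMem _ _ _ _ hv, coeff_monomial] at h2
      have hk : muOf 0 (ind1 v) = μ2 := by by_contra h'; simp [h'] at h2
      exact ⟨_, _, hF.add (Fam_ind1 v hv), by rw [muOf_add, hk]⟩

/-- the splitting of an exponent matrix given by a coloring -/
def split {m n : ℕ} (r : ℕ) (B : Finset (Fin n)) (κ : Fin m × Fin n → ℕ) (x : Fin m → Fin n → ℕ) :
    Fin r → Fin m → Fin n → ℕ :=
  fun k i j => if j ∈ B ∧ κ (i, j) = k then x i j else 0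

/-- the part outside of the columns `B` -/
def rest {m n : ℕ} (B : Finset (Fin n)) (x : Fin m → Fin n → ℕ) : Fin m → Fin n → ℕ :=
  fun i j => if j ∈ B then 0 else x i j

/-- a coloring good for an exponent matrix -/
structure Good {m n : ℕ} (r : ℕ) (B : Finset (Fin n)) (κ : Fin m × Fin n → ℕ)
    (x : Fin m → Fin n → ℕ) : Prop where
  lt : ∀ i, ∀ j ∈ B, x i j ≠ 0 → κ (i, j) < r
  ac : ∀ i, ∀ j ∈ B, ∀ i', ∀ j' ∈ B, x i j ≠ 0 → x i' j' ≠ 0 → i < i' → j < j' →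
    κ (i, j) ≠ κ (i', j')

lemma Fam_split {m n r : ℕ} {B : Finset (Fin n)} {κ : Fin m × Fin n → ℕ}
    {x : Fin m → Fin n → ℕ} (h : Good r B κ x) : Fam B x (split r B κ x) (rest B x) := by
  refine ⟨?_, fun i j hj => by simp [rest, hj], fun k i j hj => by simp [split, hj]⟩
  funext i j
  simp only [Pi.add_apply, Finset.sum_apply, split, rest]
  by_cases hj : j ∈ B
  · simp only [hj, true_and, if_true, add_zero]
    by_cases hx : x i j = 0
    · simp [hx]
    · rw [Finset.sum_eq_single (⟨κ (i, j), h.lt i j hj hx⟩ : Fin r)]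
      · simp
      · intro k _ hk
        rw [if_neg]
        intro h'
        apply hk
        ext; simp [h']
      · simp
  · simp [hj]

lemma wt_add {m n : ℕ} (x y : Fin m → Fin n → ℕ) : wt (x + y) = wt x + wt y := by
  simp [wt, mul_add, Finset.sum_add_distrib]

lemma wt_sum {m n : ℕ} {ι : Type*} (s : Finset ι) (x : ι → Fin m → Fin n → ℕ) :
    wt (∑ k ∈ s, x k) = ∑ k ∈ s, wt (x k) := by
  classical
  induction s using Finset.induction with
  | empty => simp [wt]
  | insert a s ha ih => rw [Finset.sum_insert ha, Finset.sum_insert ha, wt_add, ih]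

lemma Fam.wt_eq {m n r : ℕ} {B : Finset (Fin n)} {x : Fin m → Fin n → ℕ}
    {ν : Fin r → Fin m → Fin n → ℕ} {w : Fin m → Fin n → ℕ} (h : Fam B x ν w) :
    wt x = ∑ k, wt (ν k) + wt w := by
  rw [← h.sum, wt_add, wt_sum]

lemma KEY {m n r : ℕ} {B : Finset (Fin n)} {κ : Fin m × Fin n → ℕ}
    {x y : Fin m → Fin n → ℕ} (h : Good r B κ x) {ν : Fin r → Fin m → Fin n → ℕ}
    {w : Fin m → Fin n → ℕ} (hF : Fam B y ν w)
    (hμ : muOf ν w = muOf (split r B κ x) (rest B x)) :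
    wt x ≤ wt y ∧ (wt x = wt y → ν = split r B κ x ∧ y = x) := by
  have hS := Fam_split h
  have hw : w = rest B x := by
    funext i j
    have := DFunLike.congr_fun hμ (Sum.inr (Sum.inr (i, j)))
    rwa [muOf_inr_inr, muOf_inr_inr] at this
  have hk : ∀ k, wt (split r B κ x k) ≤ wt (ν k) ∧
      (wt (split r B κ x k) = wt (ν k) → split r B κ x k = ν k) := by
    intro k
    apply AC
    · intro i
      have := DFunLike.congr_fun hμ (Sum.inl (i, k))
      rw [muOf_inl, muOf_inl] at this
      exact this.symm
    · intro j
      have := DFunLike.congr_fun hμ (Sum.inr (Sum.inl (k, j)))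
      rw [muOf_inr_inl, muOf_inr_inl] at this
      exact this.symm
    · intro i j i' j' h1 h2 h3 h4
      simp only [split, ne_eq, ite_eq_right_iff, Classical.not_imp] at h1 h2
      exact h.ac i j h1.1.1 i' j' h2.1.1 h1.2 h2.2 h3 h4 (by rw [h1.1.2, h2.1.2])
  have hx : wt x = ∑ k, wt (split r B κ x k) + wt w := by
    rw [hw]; exact hS.wt_eq
  have hy : wt y = ∑ k, wt (ν k) + wt w := hF.wt_eq
  have hle : ∑ k, wt (split r B κ x k) ≤ ∑ k, wt (ν k) := Finset.sum_le_sum fun k _ => (hk k).1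
  refine ⟨hx.trans_le ((Nat.add_le_add_right hle _).trans hy.symm.le), fun heq => ?_⟩
  have h1 : ∑ k, wt (split r B κ x k) = ∑ k, wt (ν k) := 
    Nat.add_right_cancel (hx.symm.trans (heq.trans hy))
  have h2 : ∀ k ∈ Finset.univ, wt (split r B κ x k) = wt (ν k) :=
    (Finset.sum_eq_sum_iff_of_le (fun k _ => (hk k).1)).1 h1
  have h3 : ν = split r B κ x := by
    ext k : 1
    have h4 := h2 k (Finset.mem_univ k)
    have h5 := (hk k).2 h4
    exact h5.symm
  refine ⟨h3, ?_⟩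
  rw [← hF.sum, ← hS.sum, h3, hw]

lemma Good.mono {m n r : ℕ} {B : Finset (Fin n)} {κ : Fin m × Fin n → ℕ}
    {x x' : Fin m → Fin n → ℕ} (h : Good r B κ (x + x')) : Good r B κ x := by
  refine ⟨fun i j hj hx => h.lt i j hj (by simp [hx]), 
    fun i j hj i' j' hj' hx hx' => h.ac i j hj i' j' hj' (by simp [hx]) (by simp [hx'])⟩

lemma split_add {m n r : ℕ} {B : Finset (Fin n)} {κ : Fin m × Fin n → ℕ}
    (x x' : Fin m → Fin n → ℕ) : split r B κ (x + x') = split r B κ x + split r B κ x' := by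
  funext k i j
  simp only [split, Pi.add_apply]
  split_ifs <;> rfl

lemma rest_add {m n : ℕ} {B : Finset (Fin n)} 
    (x x' : Fin m → Fin n → ℕ) : rest B (x + x') = rest B x + rest B x' := by
  funext i j
  simp only [rest, Pi.add_apply]
  split_ifs <;> rfl

lemma split_ind {m n r : ℕ} {B : Finset (Fin n)} {κ : Fin m × Fin n → ℕ} (v : Fin m × Fin n)
    (hv : v.2 ∈ B) (k : Fin r) (hk : κ v = k) : split r B κ (ind1 v) = ind k v := by
  funext k' i j
  obtain ⟨a, b⟩ := v
  simp only [split, ind, ind1]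
  by_cases h : i = a ∧ j = b
  · obtain ⟨rfl, rfl⟩ := h
    simp only [hv, hk, true_and]
    by_cases hkk : k' = k
    · simp [hkk, ind1]
    · have : ¬ (k.val = k'.val) := fun h => hkk (Fin.ext h.symm)
      simp [hkk, this]
  · by_cases hkk : k' = k <;> simp [h, hkk, ind1]

lemma rest_ind {m n : ℕ} {B : Finset (Fin n)} (v : Fin m × Fin n)
    (hv : v.2 ∈ B) : rest B (ind1 v) = 0 := by
  funext i j
  obtain ⟨a, b⟩ := v
  simp only [rest, ind1]
  split_ifs <;> simp_all

lemma split_ind' {m n r : ℕ} {B : Finset (Fin n)} {κ : Fin m × Fin n → ℕ} (v : Fin m × Fin n)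
    (hv : v.2 ∉ B) : split r B κ (ind1 v) = 0 := by
  funext k' i j
  obtain ⟨a, b⟩ := v
  simp only [split, ind1]
  split_ifs <;> simp_all

lemma rest_ind' {m n : ℕ} {B : Finset (Fin n)} (v : Fin m × Fin n)
    (hv : v.2 ∉ B) : rest B (ind1 v) = ind1 v := by
  funext i j
  obtain ⟨a, b⟩ := v
  simp only [rest, ind1]
  split_ifs <;> simp_all

lemma L2 (K : Type*) [Field K] {m n : ℕ} {σ : Type*} (E : Fin m × Fin n ≃ σ)
    (B : Finset (Fin n)) (r : ℕ) (κ : Fin m × Fin n → ℕ) (y : σ →₀ ℕ) :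
    Good r B κ (mat E y) →
      coeff (muOf (split r B κ (mat E y)) (rest B (mat E y))) (Phi K E B r (monomial y 1)) = 1 := by
  classical
  induction y using exp_induction with
  | h0 =>
    intro h
    have h1 : (monomial (0 : σ →₀ ℕ) (1 : K)) = 1 := rfl
    have h2 : muOf (split r B κ (mat E 0)) (rest B (mat E 0)) = 0 := by
      ext s
      rcases s with ⟨i, k⟩ | ⟨k, j⟩ | ⟨i, j⟩ <;> simp [split, rest, mat]
    rw [h2, h1, map_one]
    simp
  | h1 y s ih =>
    intro h
    obtain ⟨v, rfl⟩ := E.surjective s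
    have hh := h
    rw [mat_add, mat_single] at h ⊢
    have ih := ih h.mono
    rw [Phi_mono_add, Phi_single]
    by_cases hv : v.2 ∈ B
    · rw [phiFun_of_mem _ _ _ _ hv, Finset.mul_sum, coeff_sum]
      have hκ : κ v < r := h.lt v.1 v.2 hv (by simp [ind1])
      rw [Finset.sum_eq_single (⟨κ v, hκ⟩ : Fin r)]
      · rw [split_add, rest_add, split_ind v hv ⟨κ v, hκ⟩ rfl, rest_ind v hv, muOf_add,
          coeff_mul_monomial, ih, mul_one]
      · intro k _ hk
        by_contra hne
        have h2 := support_mul _ _ (mem_support_iff.2 hne)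
        obtain ⟨μ1, h1, μ2, h2, h3⟩ := Finset.mem_add.1 h2
        obtain ⟨ν, w, hF, rfl⟩ := L1 K E B r y μ1 (mem_support_iff.1 h1)
        rw [mem_support_iff, coeff_monomial] at h2
        have hk2 : muOf (ind k v) 0 = μ2 := by by_contra h'; simp [h'] at h2
        rw [← hk2, ← muOf_add] at h3
        have := ((KEY h (hF.add (Fam_ind k v hv)) h3).2 rfl).1
        have := congrFun (congrFun (congrFun this k) v.1) v.2
        have hk' : κ v ≠ k := fun h => hk (Fin.ext h.symm)
        simp [split, ind, ind1, hv, hk'] at this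
      · simp
    · rw [phiFun_of_notMem _ _ _ _ hv, split_add, rest_add, split_ind' v hv, rest_ind' v hv, muOf_add,
          coeff_mul_monomial, ih, mul_one]

/-- chain-free exponents -/
def CF {m n : ℕ} {σ : Type*} (E : Fin m × Fin n ≃ σ) (B : Finset (Fin n)) (r : ℕ) (y : σ →₀ ℕ) :
    Prop := ¬ ∃ (R : Fin (r+1) → Fin m) (C : Fin (r+1) → Fin n), StrictMono R ∧ StrictMono C ∧
      ∀ s, C s ∈ B ∧ y (E (R s, C s)) ≠ 0

lemma CF_indep (K : Type*) [Field K] {m n : ℕ} {σ : Type*} (E : Fin m × Fin n ≃ σ)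
    (B : Finset (Fin n)) (r : ℕ) (g : MvPolynomial σ K) (hg : ∀ y ∈ g.support, CF E B r y)
    (h0 : Phi K E B r g = 0) : g = 0 := by
  by_contra hne
  obtain ⟨y, hy, hmax⟩ := Finset.exists_max_image g.support (fun y => wt (mat E y))
    (Finset.nonempty_iff_ne_empty.2 (by simpa using hne))
  obtain ⟨κ, h1, h2⟩ := mirsky r {v : Fin m × Fin n | v.2 ∈ B ∧ y (E v) ≠ 0} (hg y hy)
  have hG : Good r B κ (mat E y) :=
    ⟨fun i j hj hx => h1 (i, j) ⟨hj, hx⟩, fun i j hj i' j' hj' hx hx' h3 h4 =>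
      h2 (i, j) ⟨hj, hx⟩ (i', j') ⟨hj', hx'⟩ h3 h4⟩
  have hL := L2 K E B r κ y hG
  set μ := muOf (split r B κ (mat E y)) (rest B (mat E y)) with hμ
  have : coeff μ (Phi K E B r g) = coeff y g := by
    conv_lhs => rw [g.as_sum, map_sum, coeff_sum]
    rw [Finset.sum_eq_single y]
    · have : monomial y (coeff y g) = C (coeff y g) * monomial y 1 := by simp [C_mul_monomial]
      rw [this, ← algebraMap_eq, ← Algebra.smul_def, map_smul, coeff_smul, hL]; simp
    · intro z hz hzy
      by_contra hc
      have : monomial z (coeff z g) = C (coeff z g) * monomial z 1 := by simp [C_mul_monomial]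
      rw [this, ← algebraMap_eq, ← Algebra.smul_def, map_smul, coeff_smul] at hc
      obtain ⟨ν, w, hF, hm⟩ := L1 K E B r z μ (right_ne_zero_of_mul hc)
      have h3 := KEY hG hF hm.symm
      have h4 := hmax z hz
      exact hzy (mat_inj E (h3.2 (le_antisymm h3.1 h4)).2)
    · intro h; exact absurd hy h
  rw [h0] at this
  exact (mem_support_iff.1 hy) (by simpa using this.symm)

lemma perm_sum_lt {ι : Type*} [Fintype ι] {m n : ℕ} (ro : ι → Fin m)
    (co : ι → Fin n) (hrc : ∀ a b, ro a < ro b ↔ co a < co b) (hro : Function.Injective ro)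
    (τ : Equiv.Perm ι) (hτ : τ ≠ 1) :
    ∑ s, ((ro (τ s)).val + 1) * ((co s).val + 1) < ∑ s, ((ro s).val + 1) * ((co s).val + 1) := by
  classical
  let f : ι → ℕ := fun s => (ro s).val + 1
  let g : ι → ℕ := fun s => (co s).val + 1
  have hfg : Monovary f g := by
    intro i j hij
    have h1 : co i < co j := by simp only [g] at hij; exact Fin.lt_def.2 (by omega)
    have h2 := (hrc i j).2 h1
    simp only [f]; have := Fin.lt_def.1 h2; omega
  refine (hfg.sum_comp_perm_mul_lt_sum_mul_iff (σ := τ)).2 ?_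
  intro hm
  have hne : (Finset.univ.filter fun i => τ i ≠ i).Nonempty := by
    by_contra hne
    apply hτ
    ext i
    by_contra h
    exact hne ⟨i, by simpa using h⟩
  obtain ⟨i, hi, hmin⟩ := Finset.exists_min_image _ ro hne
  simp only [Finset.mem_filter, Finset.mem_univ, true_and] at hi hmin
  set j := τ.symm i with hj
  have hτj : τ j = i := by simp [hj]
  have hji : j ≠ i := by intro h; rw [h] at hτj; exact hi hτj
  have h1 : ro i ≤ ro j := hmin j (by rw [hτj]; exact hji.symm)
  have h2 : ro i < ro j := lt_of_le_of_ne h1 (fun h => hji (hro h).symm)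
  have h3 : co i < co j := (hrc i j).1 h2
  have h4 : f (τ i) ≤ f (τ j) := hm (i := i) (j := j) (by simp only [g]; have := Fin.lt_def.1 h3; omega)
  rw [hτj] at h4
  have h5 : ro (τ i) ≤ ro i := Fin.le_def.2 (by simp only [f] at h4; omega)
  have h6 : ro (τ i) < ro i := lt_of_le_of_ne h5 (fun h => hi (hro h))
  have h7 : ro i ≤ ro (τ i) := hmin (τ i) (fun h => hi (τ.injective h))
  exact absurd h6 (not_lt.2 h7)

/-- exponent of a permutation term of a minor -/
noncomputable def dexp {ι : Type*} [Fintype ι] {m n : ℕ} {σ : Type*} (E : Fin m × Fin n ≃ σ)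
    (ro : ι → Fin m) (co : ι → Fin n) (τ : Equiv.Perm ι) : σ →₀ ℕ :=
  ∑ s, Finsupp.single (E (ro (τ s), co s)) 1

lemma det_expand (K : Type*) [Field K] {ι : Type*} [Fintype ι] [DecidableEq ι] {m n : ℕ} {σ : Type*}
    (E : Fin m × Fin n ≃ σ) (ro : ι → Fin m) (co : ι → Fin n) :
    Matrix.det (Matrix.of fun a b => (X (E (ro a, co b)) : MvPolynomial σ K)) =
      ∑ τ : Equiv.Perm ι, Equiv.Perm.sign τ • monomial (dexp E ro co τ) 1 := by
  rw [Matrix.det_apply]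
  refine Finset.sum_congr rfl fun τ _ => ?_
  rw [dexp, monomial_sum_one]
  rfl

lemma wt_ind1 {m n : ℕ} (v : Fin m × Fin n) : wt (ind1 v) = (v.1.val + 1) * (v.2.val + 1) := by
  obtain ⟨a, b⟩ := v
  unfold wt ind1
  rw [Finset.sum_eq_single a, Finset.sum_eq_single b]
  · simp
  · intro j _ hj; simp [hj]
  · simp
  · intro i _ hi; simp [hi]
  · simp

lemma mat_sum {m n : ℕ} {σ ι : Type*} (E : Fin m × Fin n ≃ σ) (s : Finset ι) (f : ι → σ →₀ ℕ) :
    mat E (∑ k ∈ s, f k) = ∑ k ∈ s, mat E (f k) := by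
  classical
  induction s using Finset.induction with
  | empty => simp; rfl
  | insert a s ha ih => rw [Finset.sum_insert ha, Finset.sum_insert ha, mat_add, ih]

lemma wt_dexp {ι : Type*} [Fintype ι] {m n : ℕ} {σ : Type*} (E : Fin m × Fin n ≃ σ)
    (ro : ι → Fin m) (co : ι → Fin n) (τ : Equiv.Perm ι) :
    wt (mat E (dexp E ro co τ)) = ∑ s, ((ro (τ s)).val + 1) * ((co s).val + 1) := by
  rw [dexp, mat_sum, wt_sum]
  refine Finset.sum_congr rfl fun s _ => ?_
  rw [mat_single, wt_ind1]

lemma wt_dexp_lt {ι : Type*} [Fintype ι] {m n : ℕ} {σ : Type*} (E : Fin m × Fin n ≃ σ)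
    (ro : ι → Fin m) (co : ι → Fin n) (hrc : ∀ a b, ro a < ro b ↔ co a < co b)
    (hro : Function.Injective ro) (τ : Equiv.Perm ι) (hτ : τ ≠ 1) :
    wt (mat E (dexp E ro co τ)) < wt (mat E (dexp E ro co 1)) := by
  rw [wt_dexp, wt_dexp]
  exact perm_sum_lt ro co hrc hro τ hτ

/-- ideal of `t`-minors on the columns in `B` -/
noncomputable def minorIdeal (K : Type*) [Field K] {m n : ℕ} {σ : Type*} (E : Fin m × Fin n ≃ σ)
    (B : Finset (Fin n)) (t : ℕ) : Ideal (MvPolynomial σ K) :=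
  Ideal.span {p | ∃ (R : Fin t → Fin m) (C : Fin t → Fin n), StrictMono R ∧ StrictMono C ∧
    (∀ j, C j ∈ B) ∧ p = Matrix.det (Matrix.of fun i j => X (E (R i, C j)))}

lemma spanning (K : Type*) [Field K] {m n : ℕ} {σ : Type*} (E : Fin m × Fin n ≃ σ)
    (B : Finset (Fin n)) (r : ℕ) (N : ℕ) : ∀ y : σ →₀ ℕ, wt (mat E y) = N →
    (monomial y 1 : MvPolynomial σ K) ∈ (minorIdeal K E B (r+1)).restrictScalars K ⊔
      restrictSupport K {y | CF E B r y} := by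
  classical
  induction N using Nat.strong_induction_on with
  | _ N ih =>
  intro y hy
  by_cases hcf : CF E B r y
  · refine Submodule.mem_sup_right ?_
    rw [mem_restrictSupport_iff]
    intro z hz
    have := support_monomial_subset hz
    simp at this
    rw [this]; exact hcf
  · obtain ⟨R, C, hR, hC, hRC⟩ := not_not.1 hcf
    have hle : dexp E R C 1 ≤ y := by
      intro s
      rw [dexp, Finsupp.finsetSum_apply]
      by_cases hs : ∃ a, E (R a, C a) = s
      · obtain ⟨a, rfl⟩ := hs
        rw [Finset.sum_eq_single a]
        · simp; have := (hRC a).2; omega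
        · intro b _ hb
          rw [Finsupp.single_apply, if_neg]
          intro h
          have := E.injective h
          simp at this
          exact hb (hR.injective this.1)
        · simp
      · rw [Finset.sum_eq_zero]
        · exact Nat.zero_le _
        · intro a _
          rw [Finsupp.single_apply, if_neg]
          intro h; exact hs ⟨a, h⟩
    obtain ⟨y', rfl⟩ := exists_add_of_le hle
    have hdet := det_expand K E R C
    rw [← Finset.add_sum_erase _ _ (Finset.mem_univ (1 : Equiv.Perm (Fin (r+1))))] at hdet
    simp only [Equiv.Perm.sign_one, one_smul] at hdet
    have h1 : (monomial (dexp E R C 1 + y') 1 : MvPolynomial σ K) =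
        monomial y' 1 * Matrix.det (Matrix.of fun a b => (X (E (R a, C b)) : MvPolynomial σ K)) -
        ∑ τ ∈ Finset.univ.erase (1 : Equiv.Perm (Fin (r+1))),
          Equiv.Perm.sign τ • monomial (dexp E R C τ + y') 1 := by
      rw [hdet, mul_add, monomial_mul, Finset.mul_sum, add_comm y']
      have : ∀ τ : Equiv.Perm (Fin (r+1)), (monomial y' 1 : MvPolynomial σ K) *
          (Equiv.Perm.sign τ • monomial (dexp E R C τ) 1) =
          Equiv.Perm.sign τ • monomial (dexp E R C τ + y') 1 := by
        intro τ
        rw [mul_smul_comm, monomial_mul, add_comm y', one_mul]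
      simp only [this]
      simp
    rw [h1]
    refine Submodule.sub_mem _ (Submodule.mem_sup_left ?_) (Submodule.sum_mem _ fun τ hτ => ?_)
    · exact Ideal.mul_mem_left _ _ (Ideal.subset_span ⟨R, C, hR, hC, fun j => (hRC j).1, rfl⟩)
    · have hlt := wt_dexp_lt E R C (fun a b => by rw [hR.lt_iff_lt, hC.lt_iff_lt]) hR.injective τ
        (Finset.mem_erase.1 hτ).1
      have := ih (wt (mat E (dexp E R C τ + y'))) (by
        rw [← hy, mat_add, mat_add, wt_add, wt_add]; omega) _ rfl
      rcases Int.units_eq_one_or (Equiv.Perm.sign τ) with h | h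
      · rw [h, one_smul]; exact this
      · rw [h, Units.neg_smul, one_smul]; exact Submodule.neg_mem _ this

lemma det_mul_zero {R : Type*} [CommRing R] {r : ℕ} (Y : Matrix (Fin (r+1)) (Fin r) R)
    (Z : Matrix (Fin r) (Fin (r+1)) R) : (Y * Z).det = 0 := by
  let Y' : Matrix (Fin (r+1)) (Fin (r+1)) R := Matrix.of fun i => Fin.snoc (α := fun _ => R) (Y i) 0
  let Z' : Matrix (Fin (r+1)) (Fin (r+1)) R := 
    Matrix.of fun k j => Fin.snoc (α := fun _ => R) (fun k => Z k j) 0 k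
  have : Y * Z = Y' * Z' := by
    ext i j
    simp [Matrix.mul_apply, Fin.sum_univ_castSucc, Y', Z']
  rw [this, Matrix.det_mul, Matrix.det_eq_zero_of_column_eq_zero (A := Y') (Fin.last r), zero_mul]
  intro i
  simp [Y']

lemma minorIdeal_le (K : Type*) [Field K] {m n : ℕ} {σ : Type*} (E : Fin m × Fin n ≃ σ)
    (B : Finset (Fin n)) (r : ℕ) : minorIdeal K E B (r+1) ≤ RingHom.ker (Phi K E B r) := by
  rw [minorIdeal, Ideal.span_le]
  rintro _ ⟨R, C, _, _, hC, rfl⟩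
  simp only [SetLike.mem_coe, RingHom.mem_ker]
  rw [AlgHom.map_det]
  rw [← det_mul_zero (Matrix.of fun a k => X (Sum.inl (R a, k)))
    (Matrix.of fun k b => X (Sum.inr (Sum.inl (k, C b))))]
  congr 1
  ext i j : 2
  simp [Matrix.mul_apply, Phi_X, phiFun, hC]

lemma minorIdeal_eq (K : Type*) [Field K] {m n : ℕ} {σ : Type*} (E : Fin m × Fin n ≃ σ)
    (B : Finset (Fin n)) (r : ℕ) : minorIdeal K E B (r+1) = RingHom.ker (Phi K E B r) := by
  refine le_antisymm (minorIdeal_le K E B r) fun g hg => ?_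
  have h1 : g ∈ (minorIdeal K E B (r+1)).restrictScalars K ⊔ restrictSupport K {y | CF E B r y} := by
    rw [g.as_sum]
    refine Submodule.sum_mem _ fun y _ => ?_
    have : monomial y (coeff y g) = coeff y g • (monomial y 1 : MvPolynomial σ K) := by
      rw [smul_monomial]; simp
    rw [this]
    exact Submodule.smul_mem _ _ (spanning K E B r _ y rfl)
  obtain ⟨i, hi, h, hh, rfl⟩ := Submodule.mem_sup.1 h1
  have hi' : i ∈ minorIdeal K E B (r+1) := hi
  have hi2 := minorIdeal_le K E B r hi'
  have h0 : h = 0 := by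
    apply CF_indep K E B r h
    · intro y hy; exact ((mem_restrictSupport_iff _).1 hh) hy
    · rw [RingHom.mem_ker] at hg hi2
      rw [map_add, hi2, zero_add] at hg
      exact hg
  rw [h0, add_zero]; exact hi'

lemma pigeon {R ι : Type*} [CommRing R] (v : ι → R) (q : ℕ) (s : Finset ι) :
    (Ideal.span (Set.image v s)) ^ (s.card * q + 1) ≤ Ideal.span (Set.image (fun i => v i ^ (q + 1)) s) := by
  classical
  induction s using Finset.induction with
  | empty => simp
  | insert a s ha ih =>
    rw [Finset.card_insert_of_notMem ha, Finset.coe_insert, Set.image_insert_eq, Set.image_insert_eq,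
      Ideal.span_insert, Ideal.span_insert, ← Ideal.add_eq_sup, add_pow, Ideal.sum_eq_sup]
    refine Finset.sup_le fun k hk => ?_
    refine Ideal.mul_le_left.trans ?_
    rw [Finset.mem_range] at hk
    rcases le_or_gt (q + 1) k with h | h
    · refine Ideal.mul_le_left.trans (le_trans ?_ le_sup_left)
      rw [← Ideal.span_singleton_pow]
      exact Ideal.pow_le_pow_right h
    · refine Ideal.mul_le_right.trans (le_trans ((Ideal.pow_le_pow_right ?_).trans ih) le_sup_right)
      have : (s.card + 1) * q = s.card * q + q := by ring
      omega

lemma vanish {R : Type*} [CommRing R] [IsDomain R] {ι : Type*} [Fintype ι] [DecidableEq ι] {r : ℕ}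
    (M : Matrix ι ι R) (Q : Finset ι) (δ : R) (V : Ideal R) (y : Fin r → ι → R)
    (c : ι → Fin r → R) (v : ι → ι → R) (hM : ∀ q ∈ Q, δ • M q = ∑ k, c q k • y k + v q)
    (hv : ∀ q ∈ Q, ∀ i, v q i ∈ V) : δ ^ Q.card * M.det ∈ V ^ (Q.card - r) := by
  let a : ι → ι → R := fun q => if q ∈ Q then ∑ k, c q k • y k else M q
  let b : ι → ι → R := fun q => if q ∈ Q then v q else 0
  have h1 : δ ^ Q.card * M.det = Matrix.detRowAlternating (a + b) := by
    have h2 : (a + b) = Matrix.of fun i j => (if i ∈ Q then δ else 1) * M i j := by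
      funext i j
      by_cases hi : i ∈ Q
      · have := congrFun (hM i hi) j
        simp only [Pi.add_apply, a, b, hi, if_true, Matrix.of_apply]
        simpa using this.symm
      · simp [a, b, hi]
    have h3 := Matrix.det_mul_column (fun i => if i ∈ Q then δ else 1) M
    rw [h2]
    change _ = Matrix.det _
    rw [h3]
    congr 1
    rw [Finset.prod_ite_mem]; simp
  rw [h1, AlternatingMap.map_add_univ]
  refine Ideal.sum_mem _ fun s _ => ?_
  obtain ⟨N, hN⟩ : ∃ N : Matrix ι ι R, N = Matrix.of (s.piecewise a b) := ⟨_, rfl⟩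
  have hNs : ∀ i ∈ s, ∀ j, N i j = a i j := by
    intro i hi j; rw [hN]; simp [Finset.piecewise, hi]
  have hNs' : ∀ i, i ∉ s → ∀ j, N i j = b i j := by
    intro i hi j; rw [hN]; simp [Finset.piecewise, hi]
  have hgoal : Matrix.detRowAlternating (s.piecewise a b) = N.det := by rw [hN]; rfl
  rw [hgoal]
  clear hgoal hN h1
  by_cases h0 : ∃ i, i ∉ s ∧ i ∉ Q
  · obtain ⟨i, hi, hiQ⟩ := h0
    rw [Matrix.det_eq_zero_of_row_eq_zero i]
    · exact Ideal.zero_mem _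
    · intro j
      rw [hNs' i hi]
      simp [b, hiQ]
  · push Not at h0
    by_cases hcard : (s ∩ Q).card ≤ r
    · have hc : sᶜ.card + (s ∩ Q).card = Q.card := by
        rw [← Finset.card_union_of_disjoint]
        · congr 1
          ext i
          simp only [Finset.mem_union, Finset.mem_compl, Finset.mem_inter]
          by_cases hi : i ∈ s
          · simp [hi]
          · simp [hi, h0 i hi]
        · rw [Finset.disjoint_left]; intro i hi hi'
          simp at hi hi'; exact hi hi'.1
      refine Ideal.pow_le_pow_right (show Q.card - r ≤ sᶜ.card by omega) ?_
      rw [← Matrix.det_transpose, Matrix.det_apply]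
      refine Ideal.sum_mem _ fun τ _ => ?_
      have : ∏ i, N.transpose (τ i) i ∈ V ^ sᶜ.card := by
        rw [← Finset.prod_mul_prod_compl s, ← Finset.prod_const]
        apply Ideal.mul_mem_left
        apply Ideal.prod_mem_prod
        intro i hi
        have hi : i ∉ s := by simpa using hi
        rw [Matrix.transpose_apply, hNs' i hi]
        simp only [b, h0 i hi, if_true]
        exact hv i (h0 i hi) _
      rcases Int.units_eq_one_or (Equiv.Perm.sign τ) with h | h
      · rw [h, one_smul]; exact this
      · rw [h, Units.neg_smul, one_smul]; exact Ideal.neg_mem_iff _ |>.2 this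
    · have : N.det = 0 := by
        by_contra hdet
        have hli := Matrix.linearIndependent_rows_of_det_ne_zero hdet
        have hli2 : LinearIndependent R (fun i : (s ∩ Q : Finset ι) => N.row i.1) :=
          hli.comp Subtype.val Subtype.val_injective
        have hsp : Set.range (fun i : (s ∩ Q : Finset ι) => N.row i.1) ≤
            Submodule.span R (Set.range y) := by
          rintro _ ⟨⟨i, hi⟩, rfl⟩
          rw [Finset.mem_inter] at hi
          have : N.row i = ∑ k, c i k • y k := by
            funext j
            change N i j = _
            rw [hNs i hi.1]
            simp [hi.2, a]
          simp only [this]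
          exact Submodule.sum_mem _ fun k _ => Submodule.smul_mem _ _ (Submodule.subset_span ⟨k, rfl⟩)
        haveI : Fintype (Set.range y) := Fintype.ofFinite _
        have h5 := linearIndependent_le_span' _ hli2 (Set.range y) hsp
        have h6 : Cardinal.mk (s ∩ Q : Finset ι) = ((s ∩ Q).card : Cardinal) := by
          rw [Cardinal.mk_fintype, Fintype.card_coe]
        have h7 : Fintype.card (Set.range y) ≤ r := by
          have := Fintype.card_range_le y
          rwa [Fintype.card_fin] at this
        rw [h6] at h5
        have h8 : (s ∩ Q).card ≤ Fintype.card (Set.range y) := by exact_mod_cast h5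
        exact hcard (h8.trans h7)
      rw [this]; exact Ideal.zero_mem _

/-- bordered minor -/
noncomputable def vv {R : Type*} [CommRing R] {m n r : ℕ} (x : Fin m → Fin n → R) (ρ : Fin r → Fin m)
    (κ : Fin r → Fin n) (i : Fin m) (j : Fin n) : R :=
  (Matrix.of fun k l => x (ρ k) (κ l)).det * x i j -
    (fun k => x i (κ k)) ⬝ᵥ Matrix.mulVec (Matrix.of fun k l => x (ρ k) (κ l)).adjugate
      (fun l => x (ρ l) j)

lemma vv_row {R : Type*} [CommRing R] {m n r : ℕ} (x : Fin m → Fin n → R) (ρ : Fin r → Fin m)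
    (κ : Fin r → Fin n) (l : Fin r) (j : Fin n) : vv x ρ κ (ρ l) j = 0 := by
  unfold vv
  set A : Matrix (Fin r) (Fin r) R := Matrix.of fun k l => x (ρ k) (κ l) with hA
  have : (fun k => x (ρ l) (κ k)) ⬝ᵥ Matrix.mulVec A.adjugate (fun l => x (ρ l) j) =
      (Matrix.mulVec A (Matrix.mulVec A.adjugate (fun l => x (ρ l) j))) l := rfl
  rw [this, Matrix.mulVec_mulVec, Matrix.mul_adjugate, Matrix.smul_mulVec, Matrix.one_mulVec]
  simp

lemma vv_col {R : Type*} [CommRing R] {m n r : ℕ} (x : Fin m → Fin n → R) (ρ : Fin r → Fin m)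
    (κ : Fin r → Fin n) (l : Fin r) (i : Fin m) : vv x ρ κ i (κ l) = 0 := by
  unfold vv
  set A : Matrix (Fin r) (Fin r) R := Matrix.of fun k l => x (ρ k) (κ l) with hA
  have : (fun l' => x (ρ l') (κ l)) = Matrix.mulVec A (Pi.single l 1) := by
    funext k; simp [hA]
  rw [this, Matrix.mulVec_mulVec, Matrix.adjugate_mul, Matrix.smul_mulVec, Matrix.one_mulVec]
  simp [mul_comm]

lemma vv_ker {R : Type*} [CommRing R] {m n r : ℕ} (x : Fin m → Fin n → R) (ρ : Fin r → Fin m)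
    (κ : Fin r → Fin n) (Y : Matrix (Fin m) (Fin r) R) (Z : Matrix (Fin r) (Fin n) R)
    (hκ : ∀ i l, x i (κ l) = ∑ k, Y i k * Z k (κ l)) (i : Fin m) (j : Fin n)
    (hj : ∀ i, x i j = ∑ k, Y i k * Z k j) : vv x ρ κ i j = 0 := by
  unfold vv
  set A : Matrix (Fin r) (Fin r) R := Matrix.of fun k l => x (ρ k) (κ l) with hA
  let Y' : Matrix (Fin r) (Fin r) R := Matrix.of fun k l => Y (ρ k) l
  let Z' : Matrix (Fin r) (Fin r) R := Matrix.of fun k l => Z k (κ l)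
  have hA2 : A = Y' * Z' := by
    ext k l
    simp [hA, Matrix.mul_apply, Y', Z', hκ]
  have h1 : (fun l => x (ρ l) j) = Matrix.mulVec Y' (fun k => Z k j) := by
    funext l; simp [hj, Matrix.mulVec, dotProduct, Y']
  have h2 : (fun k => x i (κ k)) = Matrix.vecMul (Y i) Z' := by
    funext l; simp [hκ, Matrix.vecMul, dotProduct, Z']
  have hmat : Z' * (Z'.adjugate * Y'.adjugate) * Y' = (Y'.det * Z'.det) • 1 := by
    rw [Matrix.mul_assoc Z', Matrix.mul_assoc Z'.adjugate, Matrix.adjugate_mul, Matrix.mul_smul, Matrix.mul_one,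
      Matrix.mul_smul, Matrix.mul_adjugate, smul_smul]
  rw [h1, h2, ← Matrix.dotProduct_mulVec, hA2, Matrix.adjugate_mul_distrib, Matrix.mulVec_mulVec,
    Matrix.mulVec_mulVec, hmat, Matrix.smul_mulVec, Matrix.one_mulVec, Matrix.det_mul,
    dotProduct_smul, hj, smul_eq_mul]
  simp only [dotProduct]
  ring

lemma vv_map {R R' : Type*} [CommRing R] [CommRing R'] (f : R →+* R') {m n r : ℕ}
    (x : Fin m → Fin n → R) (ρ : Fin r → Fin m) (κ : Fin r → Fin n) (i : Fin m) (j : Fin n) :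
    f (vv x ρ κ i j) = vv (fun i j => f (x i j)) ρ κ i j := by
  unfold vv
  have h : f.mapMatrix (Matrix.of fun k l => x (ρ k) (κ l)) =
    Matrix.of fun k l => f (x (ρ k) (κ l)) := rfl
  have hadj : ∀ a b, f ((Matrix.of fun k l => x (ρ k) (κ l)).adjugate a b) =
      (Matrix.of fun k l => f (x (ρ k) (κ l))).adjugate a b := by
    intro a b
    rw [← h, ← RingHom.map_adjugate]; rfl
  rw [map_sub, map_mul, RingHom.map_det, h]
  congr 1
  simp only [dotProduct, Matrix.mulVec, map_sum, map_mul, hadj]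

/-- cells on a diagonal -/
abbrev Diag (m n : ℕ) (d : ℤ) := {v : Fin m × Fin n // ((v.2.val : ℤ) - v.1.val = d)}

/-- diagonal determinant -/
noncomputable def DD (K : Type*) [Field K] {m n : ℕ} {σ : Type*} (E : Fin m × Fin n ≃ σ) (d : ℤ) :
    MvPolynomial σ K :=
  Matrix.det (Matrix.of fun a b : Diag m n d => (X (E (a.1.1, b.1.2)) : MvPolynomial σ K))

/-- the product of all diagonal determinants -/
noncomputable def fpoly (K : Type*) [Field K] {m n : ℕ} {σ : Type*} (E : Fin m × Fin n ≃ σ) :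
    MvPolynomial σ K :=
  ∏ d ∈ Finset.Icc (-((m : ℤ) + n)) ((m : ℤ) + n), DD K E d

/-- the cells of the bordering set -/
def HH (m n a r b : ℕ) : Finset (Fin m × Fin n) :=
  Finset.univ.filter fun v => r ≤ v.1.val ∧ a + r ≤ v.2.val ∧ v.2.val < b

/-- cells of the diagonal in the strip -/
def QQ (m n a b : ℕ) (d : ℤ) : Finset (Diag m n d) :=
  Finset.univ.filter fun u => a ≤ u.1.2.val ∧ u.1.2.val < b

lemma count (m n a r b : ℕ) (d : ℤ) :
    ((HH m n a r b).filter fun v => ((v.2.val : ℤ) - v.1.val = d)).card ≤ (QQ m n a b d).card - r := by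
  classical
  set H := (HH m n a r b).filter fun v => ((v.2.val : ℤ) - v.1.val = d) with hH
  rcases H.eq_empty_or_nonempty with h | h
  · simp [h]
  obtain ⟨v0, hv0, hmin⟩ := Finset.exists_min_image H (fun v => v.1.val) h
  have hmem : ∀ v, v ∈ H ↔ ((r ≤ v.1.val ∧ a + r ≤ v.2.val ∧ v.2.val < b) ∧
      ((v.2.val : ℤ) - v.1.val = d)) := by
    intro v; simp [hH, HH]
  have hv := (hmem v0).1 hv0
  let T : Fin r → Fin m × Fin n := fun s =>
    (⟨v0.1.val - 1 - s.val, by omega⟩, ⟨v0.2.val - 1 - s.val, by omega⟩)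
  have hTinj : Function.Injective T := by
    intro s s' h
    have h1 := congrArg (fun v => v.1.val) h
    simp only [T] at h1
    ext
    omega
  have hdis : Disjoint H (Finset.univ.image T) := by
    rw [Finset.disjoint_right]
    intro v hv' hvH
    obtain ⟨s, -, rfl⟩ := Finset.mem_image.1 hv'
    have := hmin _ hvH
    simp only [T] at this
    omega
  have hsub : H ∪ Finset.univ.image T ⊆ (QQ m n a b d).map ⟨Subtype.val, Subtype.val_injective⟩ := by
    intro v hv'
    rw [Finset.mem_map]
    rcases Finset.mem_union.1 hv' with h' | h'
    · have := (hmem v).1 h'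
      refine ⟨⟨v, this.2⟩, ?_, rfl⟩
      simp only [QQ, Finset.mem_filter, Finset.mem_univ, true_and]
      omega
    · obtain ⟨s, -, rfl⟩ := Finset.mem_image.1 h'
      refine ⟨⟨T s, ?_⟩, ?_, rfl⟩
      · simp only [T]; omega
      · simp only [QQ, Finset.mem_filter, Finset.mem_univ, true_and, T]
        omega
  have := Finset.card_le_card hsub
  rw [Finset.card_map, Finset.card_union_of_disjoint hdis, Finset.card_image_of_injective _ hTinj,
    Finset.card_univ, Fintype.card_fin] at this
  omega

lemma sum_HH (m n a r b : ℕ) : (HH m n a r b).card =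
    ∑ d ∈ Finset.Icc (-((m : ℤ) + n)) ((m : ℤ) + n),
      ((HH m n a r b).filter fun v => ((v.2.val : ℤ) - v.1.val = d)).card := by
  apply Finset.card_eq_sum_card_fiberwise
  intro v _
  simp only [Finset.coe_Icc, Set.mem_Icc]
  omega

lemma DD_mem (K : Type*) [Field K] {m n r : ℕ} {σ : Type*} (E : Fin m × Fin n ≃ σ) (a b : ℕ)
    (ρ : Fin r → Fin m) (κ : Fin r → Fin n) (V : Ideal (MvPolynomial σ K))
    (hV : ∀ i, ∀ j : Fin n, a ≤ j.val → j.val < b →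
      vv (fun i j => (X (E (i, j)) : MvPolynomial σ K)) ρ κ i j ∈ V) (d : ℤ) :
    (Matrix.of fun k l => (X (E (ρ k, κ l)) : MvPolynomial σ K)).det ^ (QQ m n a b d).card *
      DD K E d ∈ V ^ ((QQ m n a b d).card - r) := by
  set x : Fin m → Fin n → MvPolynomial σ K := fun i j => X (E (i, j)) with hx
  set A : Matrix (Fin r) (Fin r) (MvPolynomial σ K) := Matrix.of fun k l => X (E (ρ k, κ l)) with hA
  have hvv : ∀ i j, A.det * x i j =
      ∑ k, (A.adjugate.mulVec (fun l => x (ρ l) j)) k * x i (κ k) + vv x ρ κ i j := by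
    intro i j
    have h1 : vv x ρ κ i j = A.det * x i j -
      (fun k => x i (κ k)) ⬝ᵥ Matrix.mulVec A.adjugate (fun l => x (ρ l) j) := rfl
    rw [h1, dotProduct_comm]
    simp only [dotProduct]
    ring
  obtain ⟨M, hM⟩ : ∃ M : Matrix (Diag m n d) (Diag m n d) (MvPolynomial σ K),
    M = (Matrix.of fun a b : Diag m n d => x a.1.1 b.1.2).transpose := ⟨_, rfl⟩
  have hDM : DD K E d = M.det := by
    rw [hM, Matrix.det_transpose]; rfl
  have hME : ∀ q u, M q u = x u.1.1 q.1.2 := by intro q u; rw [hM]; rfl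
  rw [hDM]
  clear_value A x
  clear hM hDM hA hx
  obtain ⟨c, hc⟩ : ∃ c : Diag m n d → Fin r → MvPolynomial σ K,
    ∀ q k, c q k = (A.adjugate.mulVec (fun l => x (ρ l) q.1.2)) k := ⟨_, fun _ _ => rfl⟩
  refine vanish M (QQ m n a b d) A.det V (fun k u => x u.1.1 (κ k)) c
    (fun q u => vv x ρ κ u.1.1 q.1.2) ?_ ?_
  · intro q _
    funext u
    have h2 := hvv u.1.1 q.1.2
    simp only [← hc] at h2
    simp only [Pi.smul_apply, Pi.add_apply, Finset.sum_apply, smul_eq_mul, hME]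
    exact h2
  · intro q hq u
    simp only [QQ, Finset.mem_filter, Finset.mem_univ, true_and] at hq
    exact hV _ _ hq.1 hq.2

lemma fpoly_mem (K : Type*) [Field K] {m n r : ℕ} {σ : Type*} (E : Fin m × Fin n ≃ σ) (a b : ℕ)
    (ρ : Fin r → Fin m) (κ : Fin r → Fin n) (V : Ideal (MvPolynomial σ K))
    (hV : ∀ i, ∀ j : Fin n, a ≤ j.val → j.val < b →
      vv (fun i j => (X (E (i, j)) : MvPolynomial σ K)) ρ κ i j ∈ V) :
    ∃ N, (Matrix.of fun k l => (X (E (ρ k, κ l)) : MvPolynomial σ K)).det ^ N * fpoly K E ∈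
      V ^ (HH m n a r b).card := by
  refine ⟨∑ d ∈ Finset.Icc (-((m : ℤ) + n)) ((m : ℤ) + n), (QQ m n a b d).card, ?_⟩
  rw [fpoly, ← Finset.prod_pow_eq_pow_sum, ← Finset.prod_mul_distrib, sum_HH,
    ← Finset.prod_pow_eq_pow_sum]
  apply Ideal.prod_mem_prod
  intro d _
  exact Ideal.pow_le_pow_right (count m n a r b d) (DD_mem K E a b ρ κ V hV d)

lemma local_gen (K : Type*) [Field K] {m n r : ℕ} {σ : Type*} (E : Fin m × Fin n ≃ σ)
    (B : Finset (Fin n)) (ρ : Fin r → Fin m) (κ : Fin r → Fin n) (V : Ideal (MvPolynomial σ K))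
    (hV : ∀ i, ∀ j ∈ B, vv (fun i j => (X (E (i, j)) : MvPolynomial σ K)) ρ κ i j ∈ V)
    (g : MvPolynomial σ K) (hg : Phi K E B r g = 0) :
    ∃ N, (Matrix.of fun k l => (X (E (ρ k, κ l)) : MvPolynomial σ K)).det ^ N * g ∈ V := by
  set A : Matrix (Fin r) (Fin r) (MvPolynomial σ K) := Matrix.of fun k l => X (E (ρ k, κ l)) with hA
  let q := Ideal.Quotient.mk V
  let L := Localization.Away (q A.det)
  let ψ : MvPolynomial σ K →+* L := (algebraMap (MvPolynomial σ K ⧸ V) L).comp q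
  let u : L := IsLocalization.Away.invSelf (q A.det)
  have hu : ψ A.det * u = 1 := IsLocalization.Away.mul_invSelf (q A.det)
  have hψ : ∀ y ∈ V, ψ y = 0 := by
    intro y hy
    change algebraMap _ L (q y) = 0
    rw [Ideal.Quotient.eq_zero_iff_mem.2 hy, map_zero]
  let θ : MvPolynomial (Tau m n r) K →+* L := eval₂Hom (ψ.comp C) (fun s => match s with
    | Sum.inl (i, k) => ψ (X (E (i, κ k)))
    | Sum.inr (Sum.inl (k, j)) => u * ψ ((A.adjugate.mulVec (fun l => X (E (ρ l, j)))) k)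
    | Sum.inr (Sum.inr v) => ψ (X (E v)))
  have hθ : θ.comp (Phi K E B r).toRingHom = ψ := by
    apply MvPolynomial.ringHom_ext
    · intro c
      simp [θ, Phi]
    · intro s
      obtain ⟨v, rfl⟩ := E.surjective s
      change θ (Phi K E B r (X (E v))) = _
      rw [Phi_X]
      by_cases hv : v.2 ∈ B
      · rw [phiFun, if_pos hv]
        have h1 := hψ _ (hV v.1 v.2 hv)
        simp only [vv, ← hA, map_sub, map_mul, dotProduct, map_sum] at h1
        rw [sub_eq_zero] at h1
        have h2 : ψ (X (E v)) = u * (ψ A.det * ψ (X (E (v.1, v.2)))) := by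
          rw [← mul_assoc, mul_comm u, hu, one_mul]
        rw [h2, h1, Finset.mul_sum, map_sum]
        refine Finset.sum_congr rfl fun k _ => ?_
        simp only [θ, map_mul, eval₂Hom_X']
        ring
      · rw [phiFun, if_neg hv]
        simp [θ]
  have hg2 : ψ g = 0 := by
    rw [← hθ]
    change θ (Phi K E B r g) = 0
    rw [hg, map_zero]
  have h3 : algebraMap (MvPolynomial σ K ⧸ V) L (q g) = 0 := hg2
  rw [IsLocalization.map_eq_zero_iff (Submonoid.powers (q A.det)) L] at h3
  obtain ⟨⟨_, N, rfl⟩, hN⟩ := h3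
  refine ⟨N, ?_⟩
  rw [← Ideal.Quotient.eq_zero_iff_mem, map_mul, map_pow]
  exact hN

lemma span_trace {R ι : Type*} [CommRing R] (p : ℕ) (Tr : R →+ R)
    (hTr : ∀ a x, Tr (a ^ p * x) = a * Tr x) (v : ι → R) (s : Set ι) (x : R)
    (hx : x ∈ Ideal.span (Set.image (fun i => v i ^ p) s)) : Tr x ∈ Ideal.span (Set.image v s) := by
  induction hx using Submodule.span_induction with
  | mem x hx =>
    obtain ⟨i, hi, rfl⟩ := hx
    have := hTr (v i) 1
    rw [mul_one] at this
    simp only [this]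
    exact Ideal.mul_mem_right _ _ (Ideal.subset_span ⟨i, hi, rfl⟩)
  | zero => simp
  | add x y _ _ hx hy => rw [map_add]; exact Ideal.add_mem _ hx hy
  | smul c x h hx =>
    clear hx
    induction h using Submodule.span_induction generalizing c with
    | mem x hx =>
      obtain ⟨i, hi, rfl⟩ := hx
      have := hTr (v i) c
      rw [smul_eq_mul, mul_comm c]
      simp only [this]
      exact Ideal.mul_mem_right _ _ (Ideal.subset_span ⟨i, hi, rfl⟩)
    | zero => simp
    | add x y _ _ hx hy => rw [smul_add, map_add]; exact Ideal.add_mem _ (hx _) (hy _)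
    | smul d x _ hx => rw [smul_smul]; exact hx _

lemma compat (K : Type*) [Field K] {m n : ℕ} {σ : Type*} (E : Fin m × Fin n ≃ σ) (p : ℕ)
    (hp : 1 ≤ p)
    (Tr : MvPolynomial σ K →+ MvPolynomial σ K) (hTr : ∀ a x, Tr (a ^ p * x) = a * Tr x)
    (a b r : ℕ) (hr : r ≤ m) (hab : a + r ≤ b) (hbn : b ≤ n) (B : Finset (Fin n))
    (hB : ∀ j, j ∈ B ↔ a ≤ j.val ∧ j.val < b) (g : MvPolynomial σ K)
    (hg : g ∈ minorIdeal K E B (r + 1)) :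
    Tr (fpoly K E ^ (p - 1) * g) ∈ minorIdeal K E B (r + 1) := by
  rw [minorIdeal_eq] at hg ⊢
  obtain ⟨q, rfl⟩ : ∃ q, p = q + 1 := ⟨p - 1, by omega⟩
  rw [Nat.add_sub_cancel]
  let ρ : Fin r → Fin m := fun k => ⟨k.val, by omega⟩
  let κ : Fin r → Fin n := fun k => ⟨a + k.val, by omega⟩
  have hκB : ∀ l, κ l ∈ B := fun l => by rw [hB]; simp only [κ]; omega
  let x : Fin m → Fin n → MvPolynomial σ K := fun i j => X (E (i, j))
  let v : Fin m × Fin n → MvPolynomial σ K := fun u => vv x ρ κ u.1 u.2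
  set δ := (Matrix.of fun k l => (X (E (ρ k, κ l)) : MvPolynomial σ K)).det with hδ
  set H := HH m n a r b with hH
  set V := Ideal.span (Set.image v H) with hVdef
  have hV : ∀ i, ∀ j : Fin n, a ≤ j.val → j.val < b → vv x ρ κ i j ∈ V := by
    intro i j h1 h2
    by_cases hi : i.val < r
    · have : i = ρ ⟨i.val, hi⟩ := rfl
      rw [this, vv_row]; exact Ideal.zero_mem _
    by_cases hj : j.val < a + r
    · have : j = κ ⟨j.val - a, by omega⟩ := by ext; simp only [κ]; omega
      rw [this, vv_col]; exact Ideal.zero_mem _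
    refine Ideal.subset_span ⟨(i, j), ?_, rfl⟩
    simp only [hH, HH, Finset.coe_filter, Finset.mem_univ, true_and, Set.mem_ofPred_eq]
    omega
  have hVP : V ≤ RingHom.ker (Phi K E B r) := by
    rw [hVdef, Ideal.span_le]
    rintro _ ⟨⟨i, j⟩, hij, rfl⟩
    simp only [hH, HH, Finset.coe_filter, Finset.mem_univ, true_and, Set.mem_ofPred_eq] at hij
    have hx : ∀ i, ∀ j ∈ B, Phi K E B r (x i j) = ∑ k : Fin r, X (Sum.inl (i, k)) *
        X (Sum.inr (Sum.inl (k, j))) := by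
      intro i j hj
      simp only [x]
      rw [Phi_X, phiFun, if_pos hj]
    have h1 := vv_map (Phi K E B r).toRingHom x ρ κ i j
    rw [SetLike.mem_coe, RingHom.mem_ker]
    refine h1.trans ?_
    refine vv_ker _ ρ κ (Matrix.of fun i k => X (Sum.inl (i, k)))
      (Matrix.of fun k j => X (Sum.inr (Sum.inl (k, j)))) ?_ i j ?_
    · intro i l
      exact hx i _ (hκB l)
    · intro i
      exact hx i _ ((hB j).2 (by omega))
  have hδP : δ ∉ RingHom.ker (Phi K E B r) := by
    rw [RingHom.mem_ker]
    intro h0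
    let ev : MvPolynomial (Tau m n r) K →+* K := eval (fun s => match s with
      | Sum.inl (i, k) => if i = ρ k then 1 else 0
      | Sum.inr (Sum.inl (k, j)) => if κ k = j then 1 else 0
      | Sum.inr (Sum.inr _) => 0)
    have h1 : ev (Phi K E B r δ) = 1 := by
      change (ev.comp (Phi K E B r).toRingHom) δ = 1
      rw [hδ, RingHom.map_det]
      rw [show (ev.comp (Phi K E B r).toRingHom).mapMatrix
        (Matrix.of fun k l => (X (E (ρ k, κ l)) : MvPolynomial σ K)) = 1 from ?_, Matrix.det_one]
      ext k l
      change ev (Phi K E B r (X (E (ρ k, κ l)))) = _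
      rw [Phi_X, phiFun, if_pos (hκB l), map_sum]
      have hρ : ∀ k k', ρ k = ρ k' ↔ k = k' := by
        intro k k'; simp [ρ, Fin.ext_iff]
      have hκ : ∀ k k', κ k = κ k' ↔ k = k' := by
        intro k k'; simp [κ, Fin.ext_iff]
      simp [ev, hρ, hκ, Matrix.one_apply]
    rw [h0, map_zero] at h1
    exact zero_ne_one h1
  obtain ⟨N, hN⟩ := fpoly_mem K E a b ρ κ V hV
  obtain ⟨M, hM⟩ := local_gen K E B ρ κ V (fun i j hj => hV i j ((hB j).1 hj).1 ((hB j).1 hj).2) g hg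
  rw [← hδ] at hN hM
  have h1 : (δ ^ N * fpoly K E) ^ q * (δ ^ M * g) ∈ V ^ (H.card * q + 1) := by
    rw [pow_add, pow_mul, pow_one]
    exact Ideal.mul_mem_mul (Ideal.pow_mem_pow hN q) hM
  have h2 := pigeon v q H h1
  set L := N * q + M
  have h3 : (δ ^ L) ^ (q + 1) * (fpoly K E ^ q * g) ∈ Ideal.span (Set.image (fun i => v i ^ (q + 1)) H) := by
    have : (δ ^ L) ^ (q + 1) * (fpoly K E ^ q * g) =
      (δ ^ L) ^ q * ((δ ^ N * fpoly K E) ^ q * (δ ^ M * g)) := by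
      simp only [L]; ring
    rw [this]
    exact Ideal.mul_mem_left _ _ h2
  have h4 := hVP (span_trace (q + 1) Tr hTr v H _ h3)
  rw [hTr] at h4
  have hprime : (RingHom.ker (Phi K E B r)).IsPrime := RingHom.ker_isPrime _
  rcases hprime.mem_or_mem h4 with h | h
  · exact absurd (hprime.mem_of_pow_mem _ h) hδP
  · exact h

lemma exists_sigma (K : Type*) [Field K] (p : ℕ) [Fact p.Prime] [CharP K p] :
    ∃ s : K →+ K, (∀ c d, s (c ^ p * d) = c * s d) ∧ s 1 = 1 := by
  let F := (frobenius K p).fieldRange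
  let e : K ≃+* F := (frobenius K p).rangeRestrictFieldEquiv
  have he : ∀ c, (e c : K) = c ^ p := fun c => rfl
  obtain ⟨l, hl⟩ := (Algebra.linearMap F K).exists_leftInverse_of_injective
    (LinearMap.ker_eq_bot.2 (algebraMap F K).injective)
  refine ⟨(e.symm : F →+* K).toAddMonoidHom.comp l.toAddMonoidHom, ?_, ?_⟩
  · intro c d
    change e.symm (l (c ^ p * d)) = c * e.symm (l d)
    have : c ^ p * d = e c • d := rfl
    rw [this, map_smul, smul_eq_mul, map_mul, RingEquiv.symm_apply_apply]
  · change e.symm (l 1) = 1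
    have h1 : l 1 = 1 := by
      have := LinearMap.congr_fun hl 1
      simpa using this
    rw [h1, map_one]

/-- the exponent `p e + (p - 1)` -/
noncomputable def up {σ : Type*} [Fintype σ] (p : ℕ) (e : σ →₀ ℕ) : σ →₀ ℕ :=
  Finsupp.equivFunOnFinite.symm (fun s => p * e s + (p - 1))

/-- the exponent `e / p` -/
noncomputable def down {σ : Type*} [Fintype σ] (p : ℕ) (e : σ →₀ ℕ) : σ →₀ ℕ :=
  Finsupp.equivFunOnFinite.symm (fun s => e s / p)

lemma up_apply {σ : Type*} [Fintype σ] (p : ℕ) (e : σ →₀ ℕ) (s) : up p e s = p * e s + (p - 1) := rfl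

lemma down_up {σ : Type*} [Fintype σ] (p : ℕ) (hp : 0 < p) (e : σ →₀ ℕ) : down p (up p e) = e := by
  ext s
  change (p * e s + (p - 1)) / p = e s
  rw [Nat.mul_add_div hp, Nat.div_eq_of_lt (by omega), add_zero]

open Classical in
/-- underlying function of the trace -/
noncomputable def TrF {K σ : Type*} [Field K] [Fintype σ] (p : ℕ) (s0 : K →+ K)
    (g : MvPolynomial σ K) : MvPolynomial σ K :=
  ∑ e ∈ g.support.image (down p), monomial e (s0 (coeff (up p e) g))

lemma coeff_TrF {K σ : Type*} [Field K] [Fintype σ] (p : ℕ) (hp : 0 < p) (s0 : K →+ K)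
    (g : MvPolynomial σ K) (e : σ →₀ ℕ) : coeff e (TrF p s0 g) = s0 (coeff (up p e) g) := by
  classical
  rw [TrF, coeff_sum]
  simp only [coeff_monomial]
  rw [Finset.sum_ite_eq']
  split_ifs with h
  · rfl
  · have : up p e ∉ g.support := fun h' => h (Finset.mem_image.2 ⟨_, h', down_up p hp e⟩)
    rw [notMem_support_iff.1 this, map_zero]

lemma TrF_add {K σ : Type*} [Field K] [Fintype σ] (p : ℕ) (hp : 0 < p) (s0 : K →+ K)
    (g h : MvPolynomial σ K) : TrF p s0 (g + h) = TrF p s0 g + TrF p s0 h := by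
  ext e
  rw [coeff_add, coeff_TrF p hp, coeff_TrF p hp, coeff_TrF p hp, coeff_add, map_add]

lemma TrF_mul {K σ : Type*} [Field K] [Fintype σ] (p : ℕ) [Fact p.Prime] [CharP K p] (s0 : K →+ K)
    (hs : ∀ c d, s0 (c ^ p * d) = c * s0 d)
    (a g : MvPolynomial σ K) : TrF p s0 (a ^ p * g) = a * TrF p s0 g := by
  have hp : 0 < p := (Fact.out : p.Prime).pos
  induction a using MvPolynomial.induction_on' with
  | monomial d c =>
    ext e
    rw [coeff_TrF p hp, monomial_pow, coeff_monomial_mul', coeff_monomial_mul', coeff_TrF p hp]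
    have hle : p • d ≤ up p e ↔ d ≤ e := by
      rw [Finsupp.le_def, Finsupp.le_def]
      refine forall_congr' fun s => ?_
      rw [up_apply, Finsupp.smul_apply, smul_eq_mul]
      constructor
      · intro h
        by_contra h'
        have h2 : p * (e s + 1) ≤ p * d s := Nat.mul_le_mul_left p (by omega)
        rw [mul_add] at h2
        omega
      · intro h
        have := Nat.mul_le_mul_left p h
        omega
    by_cases hd : d ≤ e
    · rw [if_pos hd, if_pos (hle.2 hd), hs]
      congr 3
      ext s
      rw [Finsupp.tsub_apply, up_apply, up_apply, Finsupp.tsub_apply, Finsupp.smul_apply, smul_eq_mul,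
        Nat.mul_sub]
      have := Nat.mul_le_mul_left p (hd s)
      omega
    · rw [if_neg hd, if_neg (fun h => hd (hle.1 h)), map_zero]
  | add a b ha hb => rw [add_pow_char, add_mul, TrF_add p hp, ha, hb, add_mul]

/-- `μ` is the top exponent of `g` -/
def Top {K σ : Type*} [Field K] {m n : ℕ} (E : Fin m × Fin n ≃ σ) (g : MvPolynomial σ K)
    (μ : σ →₀ ℕ) : Prop :=
  coeff μ g = 1 ∧ ∀ e ∈ g.support, e.degree = μ.degree ∧ (e ≠ μ → wt (mat E e) < wt (mat E μ))

lemma Top.one {K σ : Type*} [Field K] {m n : ℕ} (E : Fin m × Fin n ≃ σ) :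
    Top E (1 : MvPolynomial σ K) 0 := by
  classical
  refine ⟨by simp, fun e he => ?_⟩
  have : e = 0 := by
    rw [mem_support_iff, coeff_one] at he
    by_contra h
    exact he (if_neg fun h' => h h'.symm)
  simp [this]

lemma Top.mul {K σ : Type*} [Field K] {m n : ℕ} {E : Fin m × Fin n ≃ σ} {g h : MvPolynomial σ K}
    {μ ν : σ →₀ ℕ} (hg : Top E g μ) (hh : Top E h ν) : Top E (g * h) (μ + ν) := by
  classical
  have hle : ∀ e ∈ g.support, wt (mat E e) ≤ wt (mat E μ) := by
    intro e he
    by_cases h' : e = μ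
    · rw [h']
    · exact ((hg.2 e he).2 h').le
  have hle' : ∀ e ∈ h.support, wt (mat E e) ≤ wt (mat E ν) := by
    intro e he
    by_cases h' : e = ν
    · rw [h']
    · exact ((hh.2 e he).2 h').le
  have key : ∀ e1 ∈ g.support, ∀ e2 ∈ h.support, (e1 ≠ μ ∨ e2 ≠ ν) →
      wt (mat E (e1 + e2)) < wt (mat E (μ + ν)) := by
    intro e1 h1 e2 h2 h3
    rw [mat_add, mat_add, wt_add, wt_add]
    rcases h3 with h3 | h3
    · exact add_lt_add_of_lt_of_le ((hg.2 e1 h1).2 h3) (hle' e2 h2)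
    · exact add_lt_add_of_le_of_lt (hle e1 h1) ((hh.2 e2 h2).2 h3)
  refine ⟨?_, ?_⟩
  · rw [coeff_mul, Finset.sum_eq_single (μ, ν)]
    · simp only [hg.1, hh.1, mul_one]
    · rintro ⟨e1, e2⟩ he hne
      rw [Finset.HasAntidiagonal.mem_antidiagonal] at he
      simp only at he ⊢
      by_contra hz
      have h1 : e1 ∈ g.support := mem_support_iff.2 (left_ne_zero_of_mul hz)
      have h2 : e2 ∈ h.support := mem_support_iff.2 (right_ne_zero_of_mul hz)
      have := key e1 h1 e2 h2 (by
        by_contra hcon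
        push Not at hcon
        exact hne (Prod.ext hcon.1 hcon.2))
      rw [he] at this
      exact lt_irrefl _ this
    · intro h'
      exfalso
      apply h'
      rw [Finset.HasAntidiagonal.mem_antidiagonal]
  · intro e he
    obtain ⟨e1, h1, e2, h2, rfl⟩ := Finset.mem_add.1 (support_mul g h he)
    refine ⟨?_, fun hne => key e1 h1 e2 h2 ?_⟩
    · rw [map_add, map_add, (hg.2 e1 h1).1, (hh.2 e2 h2).1]
    · by_contra hcon
      push Not at hcon
      exact hne (by rw [hcon.1, hcon.2])

lemma Top.prod {K σ ι : Type*} [Field K] {m n : ℕ} {E : Fin m × Fin n ≃ σ} (s : Finset ι)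
    (g : ι → MvPolynomial σ K) (μ : ι → σ →₀ ℕ) (hg : ∀ i ∈ s, Top E (g i) (μ i)) :
    Top E (∏ i ∈ s, g i) (∑ i ∈ s, μ i) := by
  classical
  induction s using Finset.induction with
  | empty => exact Top.one E
  | insert a s ha ih =>
    rw [Finset.prod_insert ha, Finset.sum_insert ha]
    exact (hg a (Finset.mem_insert_self a s)).mul (ih fun i hi => hg i (Finset.mem_insert_of_mem hi))

lemma Top.pow {K σ : Type*} [Field K] {m n : ℕ} {E : Fin m × Fin n ≃ σ} {g : MvPolynomial σ K}
    {μ : σ →₀ ℕ} (hg : Top E g μ) (q : ℕ) : Top E (g ^ q) (q • μ) := by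
  induction q with
  | zero => rw [pow_zero, zero_smul]; exact Top.one E
  | succ q ih => rw [pow_succ, succ_nsmul]; exact ih.mul hg

lemma degree_dexp {ι : Type*} [Fintype ι] {m n : ℕ} {σ : Type*} (E : Fin m × Fin n ≃ σ)
    (ro : ι → Fin m) (co : ι → Fin n) (τ : Equiv.Perm ι) :
    (dexp E ro co τ).degree = Fintype.card ι := by
  rw [dexp, map_sum]
  simp

lemma Top.det (K : Type*) [Field K] {ι : Type*} [Fintype ι] [DecidableEq ι] {m n : ℕ} {σ : Type*}
    (E : Fin m × Fin n ≃ σ) (ro : ι → Fin m) (co : ι → Fin n)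
    (hrc : ∀ a b, ro a < ro b ↔ co a < co b) (hro : Function.Injective ro) :
    Top E (Matrix.det (Matrix.of fun a b => (X (E (ro a, co b)) : MvPolynomial σ K)))
      (dexp E ro co 1) := by
  classical
  rw [det_expand]
  refine ⟨?_, ?_⟩
  · rw [coeff_sum, Finset.sum_eq_single 1]
    · simp
    · intro τ _ hτ
      have hne : dexp E ro co τ ≠ dexp E ro co 1 := fun h => by
        have := wt_dexp_lt E ro co hrc hro τ hτ
        rw [h] at this
        exact lt_irrefl _ this
      rcases Int.units_eq_one_or (Equiv.Perm.sign τ) with h | h <;>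
        simp [h, Units.neg_smul, coeff_monomial, hne]
    · simp
  · intro e he
    rw [mem_support_iff, coeff_sum] at he
    obtain ⟨τ, -, hτ⟩ := Finset.exists_ne_zero_of_sum_ne_zero he
    have heq : e = dexp E ro co τ := by
      by_contra hne
      apply hτ
      rcases Int.units_eq_one_or (Equiv.Perm.sign τ) with h | h <;>
        simp [h, Units.neg_smul, coeff_monomial, Ne.symm hne]
    subst heq
    refine ⟨by rw [degree_dexp, degree_dexp], fun hne => ?_⟩
    exact wt_dexp_lt E ro co hrc hro τ (fun h => hne (by rw [h]))

lemma Top.fpoly (K : Type*) [Field K] {m n : ℕ} {σ : Type*} [Fintype σ] (E : Fin m × Fin n ≃ σ) :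
    Top E (fpoly K E) (Finsupp.equivFunOnFinite.symm (fun _ => 1)) := by
  classical
  have h1 := Top.prod (E := E) (Finset.Icc (-((m : ℤ) + n)) ((m : ℤ) + n)) (fun d => DD K E d)
    (fun d => dexp E (fun u : Diag m n d => u.1.1) (fun u => u.1.2) 1) (by
      intro d _
      apply Top.det K E (fun u : Diag m n d => u.1.1) (fun u => u.1.2)
      · rintro ⟨⟨i, j⟩, h⟩ ⟨⟨i', j'⟩, h'⟩
        dsimp only at h h' ⊢
        rw [Fin.lt_def, Fin.lt_def]
        omega
      · rintro ⟨⟨i, j⟩, h⟩ ⟨⟨i', j'⟩, h'⟩ h3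
        simp only at h3 h h'
        subst h3
        have : j = j' := by ext; omega
        subst this
        rfl)
  suffices hμ : (Finsupp.equivFunOnFinite.symm (fun _ => 1) : σ →₀ ℕ) =
      ∑ d ∈ Finset.Icc (-((m : ℤ) + n)) ((m : ℤ) + n),
        dexp E (fun u : Diag m n d => u.1.1) (fun u => u.1.2) 1 by
    rw [hμ]; exact h1
  ext s
  obtain ⟨v, rfl⟩ := E.surjective s
  change 1 = _
  simp only [dexp, Equiv.Perm.one_apply, Finsupp.finsetSum_apply, Finsupp.single_apply,
    EmbeddingLike.apply_eq_iff_eq]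
  rw [Finset.sum_eq_single ((v.2.val : ℤ) - v.1.val)]
  · rw [Finset.sum_eq_single ⟨v, rfl⟩]
    · simp
    · rintro ⟨u, hu⟩ _ hne
      rw [if_neg]
      intro h
      exact hne (Subtype.ext h)
    · simp
  · intro d _ hd
    refine Finset.sum_eq_zero fun u _ => if_neg ?_
    intro h
    apply hd
    rw [← u.2, ← h]
  · intro h
    exfalso
    apply h
    rw [Finset.mem_Icc]
    omega

lemma Tr_fpoly (K : Type*) [Field K] {m n : ℕ} {σ : Type*} [Fintype σ] (E : Fin m × Fin n ≃ σ)
    (p : ℕ) (hp : 0 < p) (s0 : K →+ K) (hs : s0 1 = 1) : TrF p s0 (fpoly K E ^ (p - 1)) = 1 := by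
  classical
  have hT := (Top.fpoly K E).pow (p - 1)
  set μ : σ →₀ ℕ := (p - 1) • (Finsupp.equivFunOnFinite.symm (fun _ => 1)) with hμ
  have hup : ∀ e, up p e = p • e + μ := by
    intro e
    ext s
    rw [up_apply, Finsupp.add_apply, hμ, Finsupp.smul_apply, Finsupp.smul_apply]
    simp
  ext e
  rw [coeff_TrF p hp, coeff_one]
  by_cases he : 0 = e
  · rw [if_pos he, ← he, hup, smul_zero, zero_add, hT.1, hs]
  · rw [if_neg he]
    have : up p e ∉ (fpoly K E ^ (p - 1)).support := by
      intro h
      have h1 := (hT.2 _ h).1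
      rw [hup, map_add, map_nsmul] at h1
      have h2 : p • e.degree = 0 := by omega
      rw [smul_eq_mul, mul_eq_zero] at h2
      rcases h2 with h2 | h2
      · omega
      · exact he ((Finsupp.degree_eq_zero_iff e).1 h2).symm
    rw [notMem_support_iff.1 this, map_zero]

lemma fpoly_symm (K : Type*) [Field K] (m n : ℕ) :
    fpoly K (Equiv.prodComm (Fin n) (Fin m)) = fpoly K (Equiv.refl (Fin m × Fin n)) := by
  unfold fpoly
  refine Finset.prod_bij (fun d _ => -d) ?_ ?_ ?_ ?_
  · intro d hd
    rw [Finset.mem_Icc] at hd ⊢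
    omega
  · intro a _ b _ h
    exact neg_injective h
  · intro d hd
    refine ⟨-d, ?_, neg_neg d⟩
    rw [Finset.mem_Icc] at hd ⊢
    omega
  · intro d _
    let e : Diag n m d ≃ Diag m n (-d) :=
      { toFun := fun u => ⟨(u.1.2, u.1.1), by have := u.2; simp only; omega⟩
        invFun := fun u => ⟨(u.1.2, u.1.1), by have := u.2; simp only; omega⟩
        left_inv := fun u => rfl
        right_inv := fun u => rfl }
    unfold DD
    rw [← Matrix.det_submatrix_equiv_self e, ← Matrix.det_transpose]
    rfl

lemma genMinors_col (K : Type*) [Field K] (m n t a b : ℕ) (B : Finset (Fin n))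
    (hB : ∀ j, j ∈ B ↔ a ≤ j.val + 1 ∧ j.val + 1 ≤ b) :
    genMinors K m n t 1 m a b = minorIdeal K (Equiv.refl (Fin m × Fin n)) B t := by
  unfold genMinors minorIdeal
  congr 1
  ext q
  constructor
  · rintro ⟨r, c, hr, hc, -, h2, rfl⟩
    exact ⟨r, c, hr, hc, fun j => (hB _).2 (h2 j), rfl⟩
  · rintro ⟨r, c, hr, hc, h2, rfl⟩
    exact ⟨r, c, hr, hc, fun i => ⟨by omega, by omega⟩, fun j => (hB _).1 (h2 j), rfl⟩

lemma genMinors_row (K : Type*) [Field K] (m n t a b : ℕ) (B : Finset (Fin m))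
    (hB : ∀ j, j ∈ B ↔ a ≤ j.val + 1 ∧ j.val + 1 ≤ b) :
    genMinors K m n t a b 1 n = minorIdeal K (Equiv.prodComm (Fin n) (Fin m)) B t := by
  unfold genMinors minorIdeal
  congr 1
  ext q
  constructor
  · rintro ⟨r, c, hr, hc, h2, -, rfl⟩
    refine ⟨c, r, hc, hr, fun j => (hB _).2 (h2 j), ?_⟩
    rw [← Matrix.det_transpose]
    rfl
  · rintro ⟨c, r, hc, hr, h2, rfl⟩
    refine ⟨r, c, hr, hc, fun j => (hB _).1 (h2 j), fun i => ⟨by omega, by omega⟩, ?_⟩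
    rw [← Matrix.det_transpose]
    rfl

lemma sum_stable {R ι : Type*} [CommRing R] (φ : R →+ R) (s : Finset ι) (P : ι → Ideal R)
    (h : ∀ i ∈ s, ∀ x ∈ P i, φ x ∈ P i) : ∀ x ∈ ∑ i ∈ s, P i, φ x ∈ ∑ i ∈ s, P i := by
  classical
  induction s using Finset.induction with
  | empty =>
    intro x hx
    rw [Finset.sum_empty] at hx ⊢
    have : x = 0 := hx
    rw [this, map_zero]
    exact Ideal.zero_mem _
  | insert a s ha ih =>
    intro x hx
    rw [Finset.sum_insert ha] at hx ⊢
    obtain ⟨y, hy, z, hz, rfl⟩ := Submodule.mem_sup.1 hx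
    rw [map_add]
    exact Submodule.mem_sup.2 ⟨_, h a (Finset.mem_insert_self a s) y hy, _,
      ih (fun i hi => h i (Finset.mem_insert_of_mem hi)) z hz, rfl⟩

lemma fsplit_of_stable {R : Type*} [CommRing R] (p : ℕ) (hp : 2 ≤ p) (φ : R →+ R)
    (h1 : φ 1 = 1) (hφ : ∀ a x, φ (a ^ p * x) = a * φ x) (I : Ideal R) (hI : ∀ x ∈ I, φ x ∈ I) :
    (∃ f : (R ⧸ I) → (R ⧸ I), (∀ x y, f (x + y) = f x + f y) ∧
      (∀ r x, f (r ^ p * x) = r * f x) ∧ f 1 = 1) ∧ I.IsRadical := by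
  constructor
  · let q := Ideal.Quotient.mk I
    have hwd : ∀ x y, q x = q y → q (φ x) = q (φ y) := by
      intro x y h
      rw [Ideal.Quotient.eq] at h ⊢
      rw [← map_sub]
      exact hI _ h
    have hsurj : Function.Surjective q := Ideal.Quotient.mk_surjective
    choose s hs using hsurj
    have hf : ∀ x, q (φ (s (q x))) = q (φ x) := fun x => hwd _ _ (hs _)
    refine ⟨fun x => q (φ (s x)), ?_, ?_, ?_⟩
    · intro x y
      dsimp only
      rw [← hs x, ← hs y, ← map_add, hf, hf, hf, map_add, map_add]
    · intro r x
      dsimp only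
      rw [← hs x, ← hs r, ← map_pow, ← map_mul, hf, hf, hφ, map_mul]
    · have := hf 1
      rw [map_one, h1, map_one] at this
      exact this
  · have hstep : ∀ x, x ^ p ∈ I → x ∈ I := by
      intro x hx
      have := hI _ hx
      have h2 := hφ x 1
      rw [mul_one, h1, mul_one] at h2
      rwa [h2] at this
    have hind : ∀ (k : ℕ) (x : R), x ^ p ^ k ∈ I → x ∈ I := by
      intro k
      induction k with
      | zero => intro x hx; simpa using hx
      | succ k ih =>
        intro x hx
        rw [pow_succ, pow_mul] at hx
        exact ih x (hstep _ hx)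
    rintro x ⟨k, hk⟩
    refine hind k x ?_
    exact Ideal.pow_mem_of_pow_mem I hk (Nat.lt_pow_self (show 1 < p by omega)).le

end SMF

/-- In positive characteristic `p`, if `I = I₁ + … + I_k` where each `Iᵢ` is an ideal of
`tᵢ`-minors on consecutive columns `aᵢ, …, bᵢ` (when `c i = true`) or on consecutive rows
`aᵢ, …, bᵢ` (when `c i = false`) of the generic `m × n` matrix, then `S/I` is F-split:
there is an additive map `φ` with `φ (a ^ p * x) = a * φ x` and `φ 1 = 1`.
In particular `I` is a radical ideal. -/
theorem sum_minors_FSplit (K : Type*) [Field K] (p : ℕ) [Fact p.Prime] [CharP K p]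
    (m n : ℕ) (hm : 0 < m) (hmn : m < n)
    (k : ℕ) (t a b : Fin k → ℕ) (c : Fin k → Bool)
    (hcol : ∀ i, c i = true →
      1 ≤ a i ∧ a i ≤ b i ∧ b i ≤ n ∧ 1 ≤ t i ∧ t i ≤ b i - a i + 1 ∧ t i ≤ m)
    (hrow : ∀ i, c i = false →
      1 ≤ a i ∧ a i ≤ b i ∧ b i ≤ m ∧ 1 ≤ t i ∧ t i ≤ b i - a i + 1 ∧ t i ≤ n)
    (I : Ideal (MvPolynomial (Fin m × Fin n) K))
    (hI : I = ∑ i, if c i then genMinors K m n (t i) 1 m (a i) (b i)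
                   else genMinors K m n (t i) (a i) (b i) 1 n) :
    (∃ φ : (MvPolynomial (Fin m × Fin n) K ⧸ I) → (MvPolynomial (Fin m × Fin n) K ⧸ I),
      (∀ x y, φ (x + y) = φ x + φ y) ∧
      (∀ r x, φ (r ^ p * x) = r * φ x) ∧
      φ 1 = 1) ∧
    I.IsRadical := by
  obtain ⟨s0, hs0, hs1⟩ := SMF.exists_sigma K p
  have hp : p.Prime := Fact.out
  set f := SMF.fpoly K (Equiv.refl (Fin m × Fin n)) with hf
  let Tr : MvPolynomial (Fin m × Fin n) K →+ MvPolynomial (Fin m × Fin n) K :=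
    AddMonoidHom.mk' (SMF.TrF p s0) (SMF.TrF_add p hp.pos s0)
  have hTr : ∀ a x, Tr (a ^ p * x) = a * Tr x := SMF.TrF_mul p s0 hs0
  let φ : MvPolynomial (Fin m × Fin n) K →+ MvPolynomial (Fin m × Fin n) K :=
    Tr.comp (AddMonoidHom.mulLeft (f ^ (p - 1)))
  have hφdef : ∀ x, φ x = Tr (f ^ (p - 1) * x) := fun x => rfl
  refine SMF.fsplit_of_stable p hp.two_le φ ?_ ?_ I ?_
  · rw [hφdef, mul_one]
    exact SMF.Tr_fpoly K (Equiv.refl (Fin m × Fin n)) p hp.pos s0 hs1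
  · intro u x
    rw [hφdef, hφdef, ← hTr]
    congr 1
    ring
  · rw [hI]
    apply SMF.sum_stable
    intro i _ x hx
    rw [hφdef]
    by_cases hc : c i = true
    · obtain ⟨h1, h2, h3, h4, h5, h6⟩ := hcol i hc
      rw [if_pos hc] at hx ⊢
      let B : Finset (Fin n) := Finset.univ.filter fun j => a i ≤ j.val + 1 ∧ j.val + 1 ≤ b i
      have hB : ∀ j, j ∈ B ↔ a i ≤ j.val + 1 ∧ j.val + 1 ≤ b i := by intro j; simp [B]
      rw [SMF.genMinors_col K m n (t i) (a i) (b i) B hB] at hx ⊢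
      obtain ⟨r, hr⟩ : ∃ r, t i = r + 1 := ⟨t i - 1, by omega⟩
      rw [hr] at hx ⊢
      refine SMF.compat K (Equiv.refl (Fin m × Fin n)) p hp.one_le Tr hTr (a i - 1) (b i) r
        (by omega) (by omega) h3 B ?_ x hx
      intro j
      rw [hB]
      omega
    · have hc : c i = false := by simpa using hc
      obtain ⟨h1, h2, h3, h4, h5, h6⟩ := hrow i hc
      rw [hc, if_neg (by simp)] at hx ⊢
      let B : Finset (Fin m) := Finset.univ.filter fun j => a i ≤ j.val + 1 ∧ j.val + 1 ≤ b i
      have hB : ∀ j, j ∈ B ↔ a i ≤ j.val + 1 ∧ j.val + 1 ≤ b i := by intro j; simp [B]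
      rw [SMF.genMinors_row K m n (t i) (a i) (b i) B hB] at hx ⊢
      obtain ⟨r, hr⟩ : ∃ r, t i = r + 1 := ⟨t i - 1, by omega⟩
      rw [hr] at hx ⊢
      rw [hf, ← SMF.fpoly_symm K m n]
      refine SMF.compat K (Equiv.prodComm (Fin n) (Fin m)) p hp.one_le Tr hTr (a i - 1) (b i) r
        (by omega) (by omega) h3 B ?_ x hx
      intro j
      rw [hB]
      omega
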